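/- arXiv:1702.07496 — 2 statements merged into one kernel-verified Lean document; each statement's English description precedes it below -/
import Mathlib

section
/- Under the convergence condition, for every z ∈ ℂ∖der(λ) the sequences f(z) and g(z) are solutions of the eigenvalue equation 𝒥u = zu, i.e., w_{n−1}u_{n−1} + (λ_n − z)u_n + w_n u_{n+1} = 0 for all n ∈ ℤ; moreover their Wronskian W(f(z),g(z)) := w_n (f_n(z) g_{n+1}(z) − f_{n+1}(z) g_n(z)) is independent of n and satisfies W(f(z),g(z)) = lim_{u→z} (u−z)^{r(z)} F_𝒥(u). -/
open Filter Topology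
open scoped Classical

noncomputable section

namespace Jacobi

/-- Admissible index tuples `k : Fin (m+1) → ℤ` with gaps `≥ 2` (an `(m+1)`-tuple,
corresponding to the `m`-th summand, `m ≥ 1`, in the paper). -/
def Tup (m : ℕ) : Type :=
  {k : Fin (m + 1) → ℤ // ∀ j : Fin m, k j.castSucc + 2 ≤ k j.succ}

/-- The function `𝔉` of Stampach--Stovicek. -/
def FF (x : ℤ → ℂ) : ℂ :=
  1 + ∑' m : ℕ, (-1 : ℂ) ^ (m + 1) * ∑' k : Tup m, ∏ j, x (k.1 j) * x (k.1 j + 1)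

/-- `𝔉` applied to the restriction of `x` to `s` (extension by zeros). -/
def FFon (s : Set ℤ) (x : ℤ → ℂ) : ℂ := FF (s.indicator x)

/-- `ℂ₀^λ`. -/
def C0 (lam : ℤ → ℂ) : Set ℂ := (closure (Set.range lam))ᶜ

/-- `der λ`: the set of (finite) accumulation points of the sequence `λ`. -/
def der (lam : ℤ → ℂ) : Set ℂ := {z | MapClusterPt z Filter.cofinite lam}

/-- The basic convergence condition (at one point of `ℂ₀^λ`). -/
def ConvCond (lam w : ℤ → ℂ) : Prop :=
  ∃ z₀ ∈ C0 lam, Summable fun n : ℤ => ‖w n ^ 2 / ((lam n - z₀) * (lam (n + 1) - z₀))‖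

/-- The characteristic function `F_𝒥`. -/
def charF (lam γ : ℤ → ℂ) (z : ℂ) : ℂ := FF fun n => γ n ^ 2 / (z - lam n)

/-- `r(z)`. -/
def rz (lam : ℤ → ℂ) (z : ℂ) : ℕ := Set.ncard {n : ℤ | lam n = z}

/-- `r₊(z)`. -/
def rp (lam : ℤ → ℂ) (z : ℂ) : ℕ := Set.ncard {n : ℤ | 0 < n ∧ lam n = z}

/-- `r₋(z)`. -/
def rm (lam : ℤ → ℂ) (z : ℂ) : ℕ := Set.ncard {n : ℤ | n ≤ 0 ∧ lam n = z}

/-- `𝒫_n(z)`. -/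
def Pz (lam w : ℤ → ℂ) (z : ℂ) (n : ℤ) : ℂ :=
  if 0 ≤ n then ∏ k ∈ Finset.Icc (1 : ℤ) n, w (k - 1) / (z - lam k)
  else ∏ k ∈ Finset.Icc (n + 1) (0 : ℤ), (z - lam k) / w (k - 1)

/-- `𝔉((γ_k²/(λ_k − z))_{k=n}^{∞})`. -/
def Fplus (lam γ : ℤ → ℂ) (z : ℂ) (n : ℤ) : ℂ :=
  FFon {k | n ≤ k} fun k => γ k ^ 2 / (lam k - z)

/-- `𝔉((γ_k²/(λ_k − z))_{k=−∞}^{n})`. -/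
def Fminus (lam γ : ℤ → ℂ) (z : ℂ) (n : ℤ) : ℂ :=
  FFon {k | k ≤ n} fun k => γ k ^ 2 / (lam k - z)

/-- `f_n(z)` for `z ∈ ℂ₀^λ`. -/
def fSol₀ (lam w γ : ℤ → ℂ) (z : ℂ) (n : ℤ) : ℂ :=
  Pz lam w z n * Fplus lam γ z (n + 1)

/-- `g_n(z)` for `z ∈ ℂ₀^λ`. -/
def gSol₀ (lam w γ : ℤ → ℂ) (z : ℂ) (n : ℤ) : ℂ :=
  (w (n - 1) * Pz lam w z (n - 1))⁻¹ * Fminus lam γ z (n - 1)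

/-- `f_n(z)` extended to `ℂ ∖ der λ` by the limit formula. -/
def fSol (lam w γ : ℤ → ℂ) (z : ℂ) (n : ℤ) : ℂ :=
  if z ∈ C0 lam then fSol₀ lam w γ z n
  else limUnder (𝓝[C0 lam] z) fun u => (u - z) ^ rp lam z * fSol₀ lam w γ u n

/-- `g_n(z)` extended to `ℂ ∖ der λ` by the limit formula. -/
def gSol (lam w γ : ℤ → ℂ) (z : ℂ) (n : ℤ) : ℂ :=
  if z ∈ C0 lam then gSol₀ lam w γ z n
  else limUnder (𝓝[C0 lam] z) fun u => (u - z) ^ rm lam z * gSol₀ lam w γ u n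

/-- The extended zero set `𝔷(𝒥)` of the characteristic function. -/
def Zset (lam w γ : ℤ → ℂ) : Set ℂ :=
  {z | z ∉ der lam ∧
    Tendsto (fun u => (u - z) ^ rz lam z * charF lam γ u) (𝓝[C0 lam] z) (𝓝 0)}

/-- The Hilbert space `ℓ²(ℤ)`. -/
abbrev ℓ2 : Type := lp (fun _ : ℤ => ℂ) 2

/-- The formal Jacobi matrix acting on sequences. -/
def Jop (lam w : ℤ → ℂ) (u : ℤ → ℂ) : ℤ → ℂ := fun n =>
  w (n - 1) * u (n - 1) + lam n * u n + w n * u (n + 1)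

lemma Jop_add (lam w : ℤ → ℂ) (u v : ℤ → ℂ) :
    Jop lam w (u + v) = Jop lam w u + Jop lam w v := by
  funext n; simp [Jop]; ring

lemma Jop_smul (lam w : ℤ → ℂ) (c : ℂ) (u : ℤ → ℂ) :
    Jop lam w (c • u) = c • Jop lam w u := by
  funext n; simp [Jop]; ring

/-- The domain of the maximal operator. -/
def JmaxDom (lam w : ℤ → ℂ) : Submodule ℂ ℓ2 where
  carrier := {x | Memℓp (Jop lam w ⇑x) 2}
  add_mem' := by
    intro x y hx hy
    show Memℓp (Jop lam w ⇑(x + y)) 2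
    rw [lp.coeFn_add, Jop_add]
    exact hx.add hy
  zero_mem' := by
    show Memℓp (Jop lam w ⇑(0 : ℓ2)) 2
    have h0 : Jop lam w ⇑(0 : ℓ2) = 0 := by
      funext n; simp [Jop, lp.coeFn_zero]
    rw [h0]
    exact zero_memℓp
  smul_mem' := by
    intro c x hx
    show Memℓp (Jop lam w ⇑(c • x)) 2
    rw [lp.coeFn_smul, Jop_smul]
    exact hx.const_smul c

/-- The maximal operator `J_max` as a partially defined linear operator on `ℓ²(ℤ)`. -/
def Jmax (lam w : ℤ → ℂ) : ℓ2 →ₗ.[ℂ] ℓ2 where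
  domain := JmaxDom lam w
  toFun :=
    { toFun := fun x => (⟨Jop lam w ⇑(x : ℓ2), x.2⟩ : ℓ2)
      map_add' := by
        intro x y
        apply lp.ext
        rw [lp.coeFn_add]
        show Jop lam w ⇑((x : ℓ2) + (y : ℓ2)) = Jop lam w ⇑(x : ℓ2) + Jop lam w ⇑(y : ℓ2)
        rw [lp.coeFn_add, Jop_add]
      map_smul' := by
        intro c x
        apply lp.ext
        rw [lp.coeFn_smul]
        show Jop lam w ⇑(c • (x : ℓ2)) = c • Jop lam w ⇑(x : ℓ2)
        rw [lp.coeFn_smul, Jop_smul] }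

/-- The standard basis vector `e n` in `ℓ²(ℤ)`. -/
def eVec (n : ℤ) : ℓ2 := lp.single 2 n (1 : ℂ)

/-- The span of the standard basis vectors. -/
def stdSpan : Submodule ℂ ℓ2 := Submodule.span ℂ (Set.range eVec)

/-- The minimal operator `J_min`: the closure of the restriction of `𝒥` to the span of the
standard basis. -/
def Jmin (lam w : ℤ → ℂ) : ℓ2 →ₗ.[ℂ] ℓ2 :=
  ((Jmax lam w).domRestrict stdSpan).closure

/-- `z` is an eigenvalue of the partially defined operator `T`. -/
def IsEV (T : ℓ2 →ₗ.[ℂ] ℓ2) (z : ℂ) : Prop :=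
  ∃ x : T.domain, (x : ℓ2) ≠ 0 ∧ T x = z • (x : ℓ2)

/-- `z` belongs to the resolvent set of `T`: `T - z` is a bijection of `Dom T` onto `ℓ²(ℤ)`
with bounded (continuous linear) inverse. -/
def InRes (T : ℓ2 →ₗ.[ℂ] ℓ2) (z : ℂ) : Prop :=
  ∃ R : ℓ2 →L[ℂ] ℓ2,
    (∀ x : T.domain, R (T x - z • (x : ℓ2)) = x) ∧
    ∀ y : ℓ2, ∃ hy : R y ∈ T.domain, T ⟨R y, hy⟩ - z • (R y) = y

/-- The spectrum of a partially defined operator. -/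
def Spec (T : ℓ2 →ₗ.[ℂ] ℓ2) : Set ℂ := {z | ¬ InRes T z}

/-- `Ker (T - z)^n`. -/
def iterKer (T : ℓ2 →ₗ.[ℂ] ℓ2) (z : ℂ) : ℕ → Set ℓ2
  | 0 => {0}
  | n + 1 => {x | ∃ hx : x ∈ T.domain, ((T ⟨x, hx⟩ : ℓ2) - z • x) ∈ iterKer T z n}

/-- The set of generalized eigenvectors of `T` at `z`. -/
def genEig (T : ℓ2 →ₗ.[ℂ] ℓ2) (z : ℂ) : Set ℓ2 :=
  {x | ∃ n : ℕ, x ∈ iterKer T z n}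

/-- `Φ_p^+`. -/
def PhiP (lam : ℤ → ℂ) (p : ℕ) (z : ℂ) : ℂ :=
  ∏' n : ℕ, ((1 - lam ((n : ℤ) + 1) / z) *
    Complex.exp (∑ j ∈ Finset.Icc 1 (p - 1), (lam ((n : ℤ) + 1) / z) ^ j / (j : ℂ)))

/-- `Φ_p^-`. -/
def PhiM (lam : ℤ → ℂ) (p : ℕ) (z : ℂ) : ℂ :=
  ∏' n : ℕ, ((1 - lam (-(n : ℤ)) / z) *
    Complex.exp (∑ j ∈ Finset.Icc 1 (p - 1), (lam (-(n : ℤ)) / z) ^ j / (j : ℂ)))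

/-- `Ψ_p^+`. -/
def PsiP (lam : ℤ → ℂ) (p : ℕ) (z : ℂ) : ℂ :=
  ∏' n : ℕ, ((1 - z / lam ((n : ℤ) + 1)) *
    Complex.exp (∑ j ∈ Finset.Icc 1 (p - 1), (z / lam ((n : ℤ) + 1)) ^ j / (j : ℂ)))

/-- `Ψ_p^-`. -/
def PsiM (lam : ℤ → ℂ) (p : ℕ) (z : ℂ) : ℂ :=
  ∏' n : ℕ, ((1 - z / lam (-(n : ℤ))) *
    Complex.exp (∑ j ∈ Finset.Icc 1 (p - 1), (z / lam (-(n : ℤ))) ^ j / (j : ℂ)))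

end Jacobi

namespace Jacobi

/-- no two consecutive elements -/
def Adm (S : Finset ℤ) : Prop := ∀ k ∈ S, k + 1 ∉ S

/-- the summand attached to a finite set -/
def tm (a : ℤ → ℂ) (S : Finset ℤ) : ℂ := if Adm S then ∏ k ∈ S, (-a k) else 0

/-- `𝔉` as a sum over finite sets -/
def GG (a : ℤ → ℂ) : ℂ := ∑' S : Finset ℤ, tm a S

lemma norm_tm_le {a : ℤ → ℂ} {b : ℤ → ℝ} (h : ∀ k, ‖a k‖ ≤ b k) (S : Finset ℤ) :
    ‖tm a S‖ ≤ ∏ k ∈ S, b k := by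
  have h0 : ∀ k, 0 ≤ b k := fun k => (norm_nonneg _).trans (h k)
  unfold tm
  split_ifs
  · rw [norm_prod]
    refine Finset.prod_le_prod (fun _ _ => norm_nonneg _) fun k _ => ?_
    rw [norm_neg]; exact h k
  · rw [norm_zero]; exact Finset.prod_nonneg fun k _ => h0 k

lemma summable_tm {a : ℤ → ℂ} (h : Summable fun k => ‖a k‖) : Summable (tm a) :=
  Summable.of_norm_bounded
    (summable_finsetProd_of_summable_nonneg (fun k => norm_nonneg (a k)) h)
    (norm_tm_le fun _ => le_rfl)

lemma GG_tendsto {ι : Type*} {l : Filter ι} {a : ι → ℤ → ℂ} {a' : ℤ → ℂ} {b : ℤ → ℝ}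
    (hb : Summable b) (h : ∀ᶠ i in l, ∀ k, ‖a i k‖ ≤ b k)
    (h0 : ∀ k, 0 ≤ b k)
    (ht : ∀ k, Tendsto (fun i => a i k) l (𝓝 (a' k))) :
    Tendsto (fun i => GG (a i)) l (𝓝 (GG a')) := by
  unfold GG
  refine tendsto_tsum_of_dominated_convergence
    (summable_finsetProd_of_summable_nonneg h0 hb) ?_ ?_
  · intro S
    unfold tm
    split_ifs
    · exact tendsto_finsetProd _ fun k _ => (ht k).neg
    · exact tendsto_const_nhds
  · filter_upwards [h] with i hi S using norm_tm_le hi S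

lemma GG_zero : GG (fun _ => 0) = 1 := by
  unfold GG
  rw [tsum_eq_single ∅]
  · simp [tm, Adm]
  · intro S hS
    unfold tm
    split_ifs
    · obtain ⟨k, hk⟩ := Finset.nonempty_iff_ne_empty.mpr hS
      exact Finset.prod_eq_zero hk (by simp)
    · rfl

/-- toggling membership of `n` -/
def toggle (n : ℤ) (S : Finset ℤ) : Finset ℤ := if n ∈ S then S.erase n else insert n S

lemma toggle_invol (n : ℤ) : Function.Involutive (toggle n) := by
  intro S
  unfold toggle
  by_cases h : n ∈ S
  · simp [h]
  · simp [h]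

lemma tm_congr_on {a b : ℤ → ℂ} {S : Finset ℤ} (h : ∀ k ∈ S, a k = b k) : tm a S = tm b S := by
  unfold tm
  rw [Finset.prod_congr rfl fun k hk => by rw [h k hk]]

lemma tm_eq_zero {a : ℤ → ℂ} {S : Finset ℤ} {k : ℤ} (hk : k ∈ S) (h : a k = 0) : tm a S = 0 := by
  unfold tm
  split_ifs
  · exact Finset.prod_eq_zero hk (by simp [h])
  · rfl

lemma GG_split {a a' a'' : ℤ → ℂ} (ha : Summable fun k => ‖a k‖) (n : ℤ)
    (h1 : ∀ k, a' k = if k = n then 0 else a k)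
    (h2 : ∀ k, a'' k = if k = n ∨ k = n - 1 ∨ k = n + 1 then 0 else a k) :
    GG a = GG a' - a n * GG a'' := by
  have s1 : Summable fun k => ‖a' k‖ := by
    refine ha.of_nonneg_of_le (fun _ => norm_nonneg _) fun k => ?_
    rw [h1]; split_ifs <;> simp
  have e1 : GG a - GG a' = ∑' S, (tm a S - tm a' S) :=
    ((summable_tm ha).tsum_sub (summable_tm s1)).symm
  have e2 : ∑' S, (tm a S - tm a' S) = -a n * GG a'' := by
    unfold GG
    rw [← tsum_mul_left, ← (toggle_invol n).toPerm.tsum_eq]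
    refine tsum_congr fun S => ?_
    show tm a (toggle n S) - tm a' (toggle n S) = _
    by_cases hn : n ∈ S
    · rw [tm_eq_zero (a := a'') hn (by simp [h2])]
      have : toggle n S = S.erase n := by simp [toggle, hn]
      rw [this, tm_congr_on (a := a) (b := a')]
      · simp
      · intro k hk
        rw [h1, if_neg (Finset.ne_of_mem_erase hk)]
    · have : toggle n S = insert n S := by simp [toggle, hn]
      rw [this, tm_eq_zero (a := a') (Finset.mem_insert_self n S) (by simp [h1]), sub_zero]
      by_cases hm : n - 1 ∈ S
      · rw [tm_eq_zero (a := a'') hm (by simp [h2]), tm, if_neg, mul_zero]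
        intro hA
        exact hA (n - 1) (Finset.mem_insert_of_mem hm) (by simp)
      by_cases hp : n + 1 ∈ S
      · rw [tm_eq_zero (a := a'') hp (by simp [h2]), tm, if_neg, mul_zero]
        intro hA
        exact hA n (Finset.mem_insert_self _ _) (Finset.mem_insert_of_mem hp)
      have hA : Adm (insert n S) ↔ Adm S := by
        constructor
        · intro h k hk hk'
          exact h k (Finset.mem_insert_of_mem hk) (Finset.mem_insert_of_mem hk')
        · intro h k hk hk'
          rw [Finset.mem_insert] at hk hk'
          rcases hk with rfl | hk
          · rcases hk' with hk' | hk'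
            · omega
            · exact hp hk'
          · rcases hk' with hk' | hk'
            · exact hm (by rwa [show n - 1 = k by omega])
            · exact h k hk hk'
      have hc : tm a'' S = tm a S := tm_congr_on fun k hk => by
        rw [h2, if_neg]
        rintro (rfl | rfl | rfl) <;> contradiction
      rw [hc]
      unfold tm
      by_cases hS : Adm S
      · rw [if_pos (hA.mpr hS), if_pos hS, Finset.prod_insert hn]
      · rw [if_neg (fun h => hS (hA.mp h)), if_neg hS, mul_zero]
  linear_combination e1 + e2

/-- the finite set of entries of a tuple -/
def toSet (p : Σ m, Tup m) : Finset ℤ := Finset.univ.image p.2.1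

lemma tup_strictMono {m : ℕ} (k : Tup m) : StrictMono k.1 :=
  Fin.strictMono_iff_lt_succ.mpr fun j => by have := k.2 j; omega

lemma toSet_card (p : Σ m, Tup m) : (toSet p).card = p.1 + 1 := by
  unfold toSet
  rw [Finset.card_image_of_injective _ (tup_strictMono p.2).injective]
  simp

lemma toSet_inj : Function.Injective toSet := by
  rintro ⟨m, k⟩ ⟨m', k'⟩ h
  have hc := congrArg Finset.card h
  rw [toSet_card, toSet_card] at hc
  simp only [add_left_inj] at hc
  subst hc
  congr 1
  apply Subtype.ext
  have hcard : (toSet ⟨m, k⟩).card = m + 1 := toSet_card _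
  have e1 := Finset.orderEmbOfFin_unique hcard (f := k.1)
    (fun x => by simp [toSet]) (tup_strictMono k)
  have e2 := Finset.orderEmbOfFin_unique hcard (f := k'.1)
    (fun x => by rw [h]; simp [toSet]) (tup_strictMono k')
  rw [e1, e2]

lemma toSet_adm (p : Σ m, Tup m) : Adm (toSet p) := by
  obtain ⟨m, k⟩ := p
  intro x hx hx'
  simp only [toSet, Finset.mem_image, Finset.mem_univ, true_and] at hx hx'
  obtain ⟨i, rfl⟩ := hx
  obtain ⟨j, hj⟩ := hx'
  have hij : i < j := (tup_strictMono k).lt_iff_lt.mp (by omega)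
  have hi : (i : ℕ) < m := by have := j.2; have : (i : ℕ) < j := hij; omega
  have h2 := k.2 ⟨i, hi⟩
  have h3 : Fin.succ ⟨(i : ℕ), hi⟩ ≤ j := by
    rw [Fin.le_def]; simpa using Fin.lt_def.mp hij
  have h4 := (tup_strictMono k).monotone h3
  have h5 : (Fin.castSucc ⟨(i : ℕ), hi⟩ : Fin (m + 1)) = i := rfl
  rw [h5] at h2
  omega

lemma toSet_surj {S : Finset ℤ} (hS : S ≠ ∅) (hA : Adm S) : S ∈ Set.range toSet := by
  obtain ⟨m, hm⟩ : ∃ m, S.card = m + 1 :=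
    Nat.exists_eq_succ_of_ne_zero (by simpa using hS)
  refine ⟨⟨m, ⟨S.orderEmbOfFin hm, fun j => ?_⟩⟩, ?_⟩
  · have h1 : S.orderEmbOfFin hm j.castSucc < S.orderEmbOfFin hm j.succ :=
      (S.orderEmbOfFin hm).strictMono (Fin.castSucc_lt_succ)
    have h2 := hA _ (S.orderEmbOfFin_mem hm j.castSucc)
    have h3 : S.orderEmbOfFin hm j.castSucc + 1 ≠ S.orderEmbOfFin hm j.succ := by
      intro h
      rw [h] at h2
      exact h2 (S.orderEmbOfFin_mem hm j.succ)
    omega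
  · unfold toSet
    apply Finset.coe_injective
    simp

lemma FF_eq {x : ℤ → ℂ} (h : Summable fun k => ‖x k * x (k + 1)‖) :
    FF x = GG fun k => x k * x (k + 1) := by
  set a : ℤ → ℂ := fun k => x k * x (k + 1) with ha
  have hs := summable_tm h
  have h1 : GG a = tm a ∅ + ∑' S : Finset ℤ, if S = ∅ then 0 else tm a S :=
    hs.tsum_eq_add_tsum_ite ∅
  have hval : ∀ p : Σ m, Tup m, (if toSet p = ∅ then 0 else tm a (toSet p)) =
      (-1 : ℂ) ^ (p.1 + 1) * ∏ j, x (p.2.1 j) * x (p.2.1 j + 1) := by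
    intro p
    have hne : toSet p ≠ ∅ := by
      intro h0
      have := toSet_card p
      rw [h0] at this
      simp at this
    rw [if_neg hne, tm, if_pos (toSet_adm p), Finset.prod_neg, toSet_card]
    congr 1
    unfold toSet
    rw [Finset.prod_image fun i _ j _ hij => (tup_strictMono p.2).injective hij]
  have h2 : ∑' S : Finset ℤ, (if S = ∅ then 0 else tm a S) =
      ∑' p : Σ m, Tup m, (-1 : ℂ) ^ (p.1 + 1) * ∏ j, x (p.2.1 j) * x (p.2.1 j + 1) := by
    rw [← toSet_inj.tsum_eq]
    · exact tsum_congr hval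
    · intro S hS
      have hS' : (if S = ∅ then 0 else tm a S) ≠ 0 := hS
      by_cases h0 : S = ∅
      · simp [h0] at hS'
      · rw [if_neg h0, tm] at hS'
        refine toSet_surj h0 ?_
        by_contra hA
        rw [if_neg hA] at hS'
        exact hS' rfl
  have h3 : Summable fun p : Σ m, Tup m =>
      (-1 : ℂ) ^ (p.1 + 1) * ∏ j, x (p.2.1 j) * x (p.2.1 j + 1) := by
    have := hs.comp_injective toSet_inj
    refine this.congr fun p => ?_
    rw [← hval, if_neg]
    · rfl
    · intro h0
      have := toSet_card p
      rw [h0] at this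
      simp at this
  rw [h1, h2, h3.tsum_sigma, FF]
  congr 1
  · simp [tm, Adm]
  · exact tsum_congr fun m => tsum_mul_left.symm

end Jacobi

namespace Jacobi

/-- the products `w_k² / ((λ_k - u)(λ_{k+1} - u))` -/
def aa (lam w : ℤ → ℂ) (u : ℂ) (k : ℤ) : ℂ := w k ^ 2 / ((lam k - u) * (lam (k + 1) - u))

lemma xx_eq {lam w γ : ℤ → ℂ} (hγ : ∀ n, γ n * γ (n + 1) = w n) (u : ℂ) (k : ℤ) :
    γ k ^ 2 / (lam k - u) * (γ (k + 1) ^ 2 / (lam (k + 1) - u)) = aa lam w u k := by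
  rw [aa, ← hγ, div_mul_div_comm, mul_pow]

lemma charF_eq {lam w γ : ℤ → ℂ} (hγ : ∀ n, γ n * γ (n + 1) = w n) {u : ℂ}
    (h : Summable fun k => ‖aa lam w u k‖) : charF lam γ u = GG (aa lam w u) := by
  have e : (fun k : ℤ => γ k ^ 2 / (u - lam k) * (γ (k + 1) ^ 2 / (u - lam (k + 1)))) =
      aa lam w u := by
    funext k
    rw [← xx_eq hγ, ← neg_sub (lam k), ← neg_sub (lam (k + 1)), div_neg, div_neg, neg_mul_neg]
  unfold charF
  rw [FF_eq, e]
  have := h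
  rw [← e] at this
  exact this

lemma Fplus_eq {lam w γ : ℤ → ℂ} (hγ : ∀ n, γ n * γ (n + 1) = w n) {u : ℂ} {n : ℤ}
    (h : Summable fun k => ‖if n ≤ k then aa lam w u k else 0‖) :
    Fplus lam γ u n = GG (fun k => if n ≤ k then aa lam w u k else 0) := by
  have e : (fun k : ℤ => ({k | n ≤ k} : Set ℤ).indicator (fun k => γ k ^ 2 / (lam k - u)) k *
      ({k | n ≤ k} : Set ℤ).indicator (fun k => γ k ^ 2 / (lam k - u)) (k + 1)) =
      (fun k => if n ≤ k then aa lam w u k else 0) := by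
    funext k
    simp only [Set.indicator_apply, Set.mem_ofPred_eq]
    by_cases hk : n ≤ k
    · rw [if_pos hk, if_pos (by omega), if_pos hk, xx_eq hγ]
    · rw [if_neg hk, if_neg hk, zero_mul]
  unfold Fplus FFon
  rw [FF_eq, e]
  have := h
  simp only [← congrFun e] at this
  exact this

lemma Fminus_eq {lam w γ : ℤ → ℂ} (hγ : ∀ n, γ n * γ (n + 1) = w n) {u : ℂ} {n : ℤ}
    (h : Summable fun k => ‖if k + 1 ≤ n then aa lam w u k else 0‖) :
    Fminus lam γ u n = GG (fun k => if k + 1 ≤ n then aa lam w u k else 0) := by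
  have e : (fun k : ℤ => ({k | k ≤ n} : Set ℤ).indicator (fun k => γ k ^ 2 / (lam k - u)) k *
      ({k | k ≤ n} : Set ℤ).indicator (fun k => γ k ^ 2 / (lam k - u)) (k + 1)) =
      (fun k => if k + 1 ≤ n then aa lam w u k else 0) := by
    funext k
    simp only [Set.indicator_apply, Set.mem_ofPred_eq]
    by_cases hk : k + 1 ≤ n
    · rw [if_pos hk, if_pos (by omega), if_pos hk, xx_eq hγ]
    · rw [if_neg hk, if_neg hk, mul_zero]
  unfold Fminus FFon
  rw [FF_eq, e]
  have := h
  simp only [← congrFun e] at this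
  exact this

lemma dist_bound {l u z₀ : ℂ} {δ D : ℝ} (hδ : 0 < δ) (h : δ ≤ ‖l - u‖) (hD : ‖u - z₀‖ ≤ D) :
    ‖l - z₀‖ ≤ (1 + D / δ) * ‖l - u‖ := by
  have h1 : ‖l - z₀‖ ≤ ‖l - u‖ + ‖u - z₀‖ := by
    have := norm_add_le (l - u) (u - z₀)
    simpa using this
  have hD0 : 0 ≤ D := (norm_nonneg _).trans hD
  have h2 : D ≤ D / δ * ‖l - u‖ := by
    calc D = D / δ * δ := by field_simp
      _ ≤ _ := by gcongr
  linarith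

lemma aa_bound {lam w : ℤ → ℂ} {u z₀ : ℂ} {k : ℤ} {δ D : ℝ} (hδ : 0 < δ)
    (h0 : lam k ≠ z₀) (h0' : lam (k + 1) ≠ z₀)
    (h : δ ≤ ‖lam k - u‖) (h' : δ ≤ ‖lam (k + 1) - u‖) (hD : ‖u - z₀‖ ≤ D) :
    ‖aa lam w u k‖ ≤ (1 + D / δ) ^ 2 * ‖aa lam w z₀ k‖ := by
  have hp := dist_bound hδ h hD
  have hq := dist_bound hδ h' hD
  have hp0 : 0 < ‖lam k - z₀‖ := norm_pos_iff.mpr (sub_ne_zero.mpr h0)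
  have hq0 : 0 < ‖lam (k + 1) - z₀‖ := norm_pos_iff.mpr (sub_ne_zero.mpr h0')
  have hD0 : 0 ≤ D := (norm_nonneg _).trans hD
  have hC : 0 ≤ 1 + D / δ := by positivity
  have hpp : 0 < ‖lam k - u‖ := hδ.trans_le h
  have hqq : 0 < ‖lam (k + 1) - u‖ := hδ.trans_le h'
  unfold aa
  rw [norm_div, norm_div, norm_mul, norm_mul, ← mul_div_assoc,
    div_le_div_iff₀ (by positivity) (by positivity)]
  calc _ ≤ ‖w k ^ 2‖ * (((1 + D / δ) * ‖lam k - u‖) * ((1 + D / δ) * ‖lam (k + 1) - u‖)) := by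
        gcongr
    _ = _ := by ring

lemma C0_ne {lam : ℤ → ℂ} {u : ℂ} (hu : u ∈ C0 lam) (k : ℤ) : lam k ≠ u := by
  rintro rfl
  exact hu (subset_closure ⟨k, rfl⟩)

lemma C0_sep {lam : ℤ → ℂ} {u : ℂ} (hu : u ∈ C0 lam) : ∃ δ > 0, ∀ k, δ ≤ ‖lam k - u‖ := by
  have h : ¬ u ∈ closure (Set.range lam) := hu
  rw [Metric.mem_closure_range_iff] at h
  push Not at h
  obtain ⟨δ, hδ, h⟩ := h
  exact ⟨δ, hδ, fun k => by rw [← dist_eq_norm, dist_comm]; exact h k⟩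

lemma summable_aa {lam w : ℤ → ℂ} (hconv : ConvCond lam w) {u : ℂ} (hu : u ∈ C0 lam) :
    Summable fun k => ‖aa lam w u k‖ := by
  obtain ⟨z₀, hz₀, hs⟩ := hconv
  obtain ⟨δ, hδ, h⟩ := C0_sep hu
  refine (hs.mul_left ((1 + ‖u - z₀‖ / δ) ^ 2)).of_nonneg_of_le (fun _ => norm_nonneg _) fun k => ?_
  exact aa_bound hδ (C0_ne hz₀ _) (C0_ne hz₀ _) (h _) (h _) le_rfl

lemma summable_if {a : ℤ → ℂ} (h : Summable fun k => ‖a k‖) (p : ℤ → Prop)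
    [DecidablePred p] :
    Summable fun k => ‖if p k then a k else 0‖ := by
  refine h.of_nonneg_of_le (fun _ => norm_nonneg _) fun k => ?_
  split_ifs <;> simp

lemma Fplus_rec {lam w γ : ℤ → ℂ} (hγ : ∀ n, γ n * γ (n + 1) = w n) {u : ℂ}
    (h : Summable fun k => ‖aa lam w u k‖) (n : ℤ) :
    Fplus lam γ u n = Fplus lam γ u (n + 1) - aa lam w u n * Fplus lam γ u (n + 2) := by
  rw [Fplus_eq hγ (summable_if h _), Fplus_eq hγ (summable_if h _),
    Fplus_eq hγ (summable_if h _)]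
  rw [GG_split (a' := fun k => if n + 1 ≤ k then aa lam w u k else 0)
    (a'' := fun k => if n + 2 ≤ k then aa lam w u k else 0) (summable_if h _) n]
  · simp
  · intro k; grind
  · intro k; grind

lemma Fminus_rec {lam w γ : ℤ → ℂ} (hγ : ∀ n, γ n * γ (n + 1) = w n) {u : ℂ}
    (h : Summable fun k => ‖aa lam w u k‖) (n : ℤ) :
    Fminus lam γ u (n + 1) = Fminus lam γ u n - aa lam w u n * Fminus lam γ u (n - 1) := by
  rw [Fminus_eq hγ (summable_if h _), Fminus_eq hγ (summable_if h _),
    Fminus_eq hγ (summable_if h _)]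
  rw [GG_split (a' := fun k => if k + 1 ≤ n then aa lam w u k else 0)
    (a'' := fun k => if k + 1 ≤ n - 1 then aa lam w u k else 0) (summable_if h _) n]
  · simp
  · intro k; grind
  · intro k; grind

lemma Fplus_lim {lam w γ : ℤ → ℂ} (hγ : ∀ n, γ n * γ (n + 1) = w n) {u : ℂ}
    (h : Summable fun k => ‖aa lam w u k‖) :
    Tendsto (Fplus lam γ u) atBot (𝓝 (charF lam γ u)) := by
  rw [charF_eq hγ h]
  have : Fplus lam γ u = fun n => GG (fun k => if n ≤ k then aa lam w u k else 0) :=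
    funext fun n => Fplus_eq hγ (summable_if h _)
  rw [this]
  refine GG_tendsto h (Eventually.of_forall fun n k => ?_) (fun _ => norm_nonneg _) fun k => ?_
  · split_ifs <;> simp
  · refine tendsto_const_nhds.congr' ?_
    filter_upwards [eventually_le_atBot k] with n hn
    rw [if_pos hn]

lemma Fminus_lim {lam w γ : ℤ → ℂ} (hγ : ∀ n, γ n * γ (n + 1) = w n) {u : ℂ}
    (h : Summable fun k => ‖aa lam w u k‖) :
    Tendsto (Fminus lam γ u) atBot (𝓝 1) := by
  have : Fminus lam γ u = fun n => GG (fun k => if k + 1 ≤ n then aa lam w u k else 0) :=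
    funext fun n => Fminus_eq hγ (summable_if h _)
  rw [this, ← GG_zero]
  refine GG_tendsto h (Eventually.of_forall fun n k => ?_) (fun _ => norm_nonneg _) fun k => ?_
  · split_ifs <;> simp
  · refine tendsto_const_nhds.congr' ?_
    filter_upwards [eventually_le_atBot k] with n hn
    rw [if_neg (by omega)]

lemma charF_wr {lam w γ : ℤ → ℂ} (hγ : ∀ n, γ n * γ (n + 1) = w n) {u : ℂ}
    (h : Summable fun k => ‖aa lam w u k‖) (n : ℤ) :
    Fminus lam γ u n * Fplus lam γ u (n + 1) -
      aa lam w u n * Fminus lam γ u (n - 1) * Fplus lam γ u (n + 2) = charF lam γ u := by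
  set W : ℤ → ℂ := fun n => Fminus lam γ u n * Fplus lam γ u (n + 1) -
      aa lam w u n * Fminus lam γ u (n - 1) * Fplus lam γ u (n + 2) with hW
  have step : ∀ n, W (n + 1) = W n := by
    intro n
    have e1 := Fminus_rec hγ h n
    have e2 := Fplus_rec hγ h (n + 1)
    simp only [hW]
    rw [show n + 1 - 1 = n by ring, show n + 1 + 2 = n + 3 by ring,
      show n + 1 + 1 = n + 2 by ring] at *
    rw [e1, e2]
    ring
  have const : ∀ m, W m = W n := by
    intro m
    have up : ∀ (j : ℕ) (i : ℤ), W (i + j) = W i := by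
      intro j i
      induction j with
      | zero => simp
      | succ j ih => rw [← ih, ← step (i + j)]; push_cast; rw [add_assoc]
    rcases le_total m n with hmn | hmn
    · have := up (n - m).toNat m
      rw [Int.toNat_of_nonneg (by omega)] at this
      rw [← this]; congr 1; omega
    · have := up (m - n).toNat n
      rw [Int.toNat_of_nonneg (by omega)] at this
      rw [← this]; congr 1; omega
  have hadd : ∀ c : ℤ, Tendsto (fun n : ℤ => n + c) atBot atBot := fun c =>
    tendsto_atBot_add_const_right _ c tendsto_id
  have ha : Tendsto (aa lam w u) atBot (𝓝 0) := by
    have := h.tendsto_cofinite_zero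
    rw [Int.cofinite_eq] at this
    exact tendsto_zero_iff_norm_tendsto_zero.mpr (this.mono_left le_sup_left)
  have hlim : Tendsto W atBot (𝓝 (1 * charF lam γ u - 0 * 1 * charF lam γ u)) := by
    refine Tendsto.sub ((Fminus_lim hγ h).mul ((Fplus_lim hγ h).comp (hadd 1))) ?_
    exact (ha.mul ((Fminus_lim hγ h).comp (hadd (-1)))).mul ((Fplus_lim hγ h).comp (hadd 2))
  have hc : Tendsto W atBot (𝓝 (W n)) := by
    rw [show W = fun _ => W n from funext const]
    exact tendsto_const_nhds
  have := tendsto_nhds_unique hc hlim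
  show W n = _
  rw [this]; ring

lemma Pz_succ {lam w : ℤ → ℂ} (hw : ∀ n, w n ≠ 0) {u : ℂ} (hu : ∀ k, lam k ≠ u) (n : ℤ) :
    Pz lam w u (n + 1) = Pz lam w u n * (w n / (u - lam (n + 1))) := by
  have hs : u - lam (n + 1) ≠ 0 := sub_ne_zero.mpr (hu _).symm
  unfold Pz
  by_cases hn : 0 ≤ n
  · rw [if_pos hn, if_pos (by omega)]
    have : Finset.Icc (1 : ℤ) (n + 1) = insert (n + 1) (Finset.Icc 1 n) := by
      ext k; simp only [Finset.mem_Icc, Finset.mem_insert]; omega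
    rw [this, Finset.prod_insert (by simp), mul_comm]
    simp
  · rw [if_neg hn]
    have e : (if 0 ≤ n + 1 then ∏ k ∈ Finset.Icc (1 : ℤ) (n + 1), w (k - 1) / (u - lam k)
      else ∏ k ∈ Finset.Icc (n + 1 + 1) (0 : ℤ), (u - lam k) / w (k - 1)) =
        ∏ k ∈ Finset.Icc (n + 1 + 1) (0 : ℤ), (u - lam k) / w (k - 1) := by
      split_ifs with h
      · obtain rfl : n = -1 := by omega
        simp
      · rfl
    have : Finset.Icc (n + 1) (0 : ℤ) = insert (n + 1) (Finset.Icc (n + 1 + 1) 0) := by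
      ext k; simp only [Finset.mem_Icc, Finset.mem_insert]; omega
    rw [e, this, Finset.prod_insert (by simp)]
    have := hw n
    simp only [add_sub_cancel_right]
    field_simp

lemma Pz_ne {lam w : ℤ → ℂ} (hw : ∀ n, w n ≠ 0) {u : ℂ} (hu : ∀ k, lam k ≠ u) (n : ℤ) :
    Pz lam w u n ≠ 0 := by
  have hs : ∀ k, u - lam k ≠ 0 := fun k => sub_ne_zero.mpr (hu _).symm
  unfold Pz
  split_ifs
  · exact Finset.prod_ne_zero_iff.mpr fun k _ => div_ne_zero (hw _) (hs _)
  · exact Finset.prod_ne_zero_iff.mpr fun k _ => div_ne_zero (hs _) (hw _)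

lemma f_rec {lam w γ : ℤ → ℂ} (hw : ∀ n, w n ≠ 0) (hγ : ∀ n, γ n * γ (n + 1) = w n)
    (hconv : ConvCond lam w) {u : ℂ} (hu : u ∈ C0 lam) (n : ℤ) :
    w (n - 1) * fSol₀ lam w γ u (n - 1) + (lam n - u) * fSol₀ lam w γ u n
        + w n * fSol₀ lam w γ u (n + 1) = 0 := by
  have hne := C0_ne hu
  have hs : ∀ k, lam k - u ≠ 0 := fun k => sub_ne_zero.mpr (hne _)
  have hs' : ∀ k, u - lam k ≠ 0 := fun k => sub_ne_zero.mpr (hne _).symm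
  have h1 := Pz_succ hw hne n
  have h2 := Pz_succ hw hne (n - 1)
  have h3 := Fplus_rec hγ (summable_aa hconv hu) n
  rw [sub_add_cancel] at h2
  unfold fSol₀
  rw [h1, h2, sub_add_cancel, show n + 1 + 1 = n + 2 by ring, h3, aa]
  have a1 := hs n
  have a2 := hs (n + 1)
  rw [← neg_sub (lam n), ← neg_sub (lam (n + 1))]
  field_simp
  ring

lemma g_rec {lam w γ : ℤ → ℂ} (hw : ∀ n, w n ≠ 0) (hγ : ∀ n, γ n * γ (n + 1) = w n)
    (hconv : ConvCond lam w) {u : ℂ} (hu : u ∈ C0 lam) (n : ℤ) :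
    w (n - 1) * gSol₀ lam w γ u (n - 1) + (lam n - u) * gSol₀ lam w γ u n
        + w n * gSol₀ lam w γ u (n + 1) = 0 := by
  have hne := C0_ne hu
  have hs : ∀ k, lam k - u ≠ 0 := fun k => sub_ne_zero.mpr (hne _)
  have h1 := Pz_succ hw hne (n - 1)
  have h2 := Pz_succ hw hne (n - 1 - 1)
  have h3 := Fminus_rec hγ (summable_aa hconv hu) (n - 1)
  have h4 := Pz_ne hw hne (n - 1 - 1)
  rw [sub_add_cancel] at h1 h2 h3
  unfold gSol₀
  rw [add_sub_cancel_right, h1, h2, h3, aa, sub_add_cancel]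
  have a1 := hs n
  have a2 := hs (n - 1)
  have w1 := hw n
  have w2 := hw (n - 1)
  have w3 := hw (n - 1 - 1)
  rw [← neg_sub (lam n), ← neg_sub (lam (n - 1))]
  field_simp
  ring

lemma wr₀ {lam w γ : ℤ → ℂ} (hw : ∀ n, w n ≠ 0) (hγ : ∀ n, γ n * γ (n + 1) = w n)
    (hconv : ConvCond lam w) {u : ℂ} (hu : u ∈ C0 lam) (n : ℤ) :
    w n * (fSol₀ lam w γ u n * gSol₀ lam w γ u (n + 1) -
      fSol₀ lam w γ u (n + 1) * gSol₀ lam w γ u n) = charF lam γ u := by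
  have hne := C0_ne hu
  have hs : ∀ k, lam k - u ≠ 0 := fun k => sub_ne_zero.mpr (hne _)
  have h1 := Pz_succ hw hne n
  have h2 := Pz_succ hw hne (n - 1)
  have h4 := Pz_ne hw hne (n - 1)
  rw [sub_add_cancel] at h2
  rw [← charF_wr hγ (summable_aa hconv hu) n]
  unfold gSol₀ fSol₀
  rw [add_sub_cancel_right, h1, h2, aa, show n + 1 + 1 = n + 2 by ring]
  have a1 := hs n
  have a2 := hs (n + 1)
  have w1 := hw n
  have w2 := hw (n - 1)
  rw [← neg_sub (lam n), ← neg_sub (lam (n + 1))]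
  field_simp
  try ring

lemma der_sep {lam : ℤ → ℂ} {z : ℂ} (hz : z ∉ der lam) :
    {k | lam k = z}.Finite ∧ ∃ δ > 0, ∀ k, lam k ≠ z → δ ≤ ‖lam k - z‖ := by
  have h : ¬ MapClusterPt z cofinite lam := hz
  rw [mapClusterPt_iff_frequently] at h
  push Not at h
  obtain ⟨s, hs, h⟩ := h
  have hT : {k | lam k ∈ s}.Finite := by
    have h' : ∀ᶠ k in cofinite, lam k ∉ s := by simpa only [not_frequently] using h
    rw [Filter.eventually_cofinite] at h'
    simpa only [not_not] using h'
  refine ⟨hT.subset fun k hk => ?_, ?_⟩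
  · have : lam k = z := hk
    show lam k ∈ s
    rw [this]; exact mem_of_mem_nhds hs
  · have hfin : ((lam '' {k | lam k ∈ s}) \ {z}).Finite := (hT.image _).subset Set.sdiff_subset
    have hn : ((lam '' {k | lam k ∈ s}) \ {z})ᶜ ∈ 𝓝 z :=
      hfin.isClosed.isOpen_compl.mem_nhds (by simp)
    obtain ⟨δ, hδ, hb⟩ := Metric.mem_nhds_iff.mp (Filter.inter_mem hs hn)
    refine ⟨δ, hδ, fun k hk => ?_⟩
    by_contra hlt
    have hm : lam k ∈ Metric.ball z δ := by
      rw [Metric.mem_ball, dist_eq_norm]; exact not_le.mp hlt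
    obtain ⟨h1, h2⟩ := hb hm
    exact h2 ⟨⟨k, h1, rfl⟩, hk⟩

lemma neBot_C0 {lam : ℤ → ℂ} {z : ℂ} (hz : z ∉ der lam) : (𝓝[C0 lam] z).NeBot := by
  obtain ⟨-, δ, hδ, h⟩ := der_sep hz
  have hle : 𝓝[≠] z ≤ 𝓝[C0 lam] z := by
    refine le_inf inf_le_left (le_principal_iff.mpr ?_)
    filter_upwards [self_mem_nhdsWithin,
      mem_nhdsWithin_of_mem_nhds (Metric.ball_mem_nhds z hδ)] with u hu hu'
    have hu0 : 0 < dist u z := dist_pos.mpr hu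
    have hu1 : dist u z < δ := hu'
    show ¬ u ∈ closure (Set.range lam)
    rw [Metric.mem_closure_range_iff]
    push Not
    refine ⟨min (dist u z) (δ - dist u z), lt_min hu0 (by linarith), fun k => ?_⟩
    by_cases hk : lam k = z
    · rw [hk]; exact min_le_left _ _
    · refine (min_le_right _ _).trans ?_
      have h1 := h k hk
      rw [← dist_eq_norm] at h1
      have := dist_triangle (lam k) u z
      rw [dist_comm (lam k) u] at this
      linarith
  exact NeBot.mono inferInstance hle

/-- continuity of restricted `𝔉` -/
lemma GG_cont {lam w : ℤ → ℂ} (hconv : ConvCond lam w) {z : ℂ} (hz : z ∉ der lam)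
    (p : ℤ → Prop) [DecidablePred p] (hp : ∀ k, p k → lam k ≠ z ∧ lam (k + 1) ≠ z) :
    Tendsto (fun u => GG fun k => if p k then aa lam w u k else 0) (𝓝[C0 lam] z)
      (𝓝 (GG fun k => if p k then aa lam w z k else 0)) := by
  obtain ⟨z₀, hz₀, hs⟩ := hconv
  obtain ⟨-, δ, hδ, h⟩ := der_sep hz
  refine GG_tendsto (b := fun k => (1 + (‖z - z₀‖ + δ / 2) / (δ / 2)) ^ 2 * ‖aa lam w z₀ k‖)
    (hs.mul_left _) ?_ (fun _ => by positivity) ?_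
  · filter_upwards [mem_nhdsWithin_of_mem_nhds (Metric.ball_mem_nhds z (half_pos hδ))] with u hu k
    have hu' : ‖u - z‖ < δ / 2 := by rw [← dist_eq_norm]; exact hu
    have hsep : ∀ k, lam k ≠ z → δ / 2 ≤ ‖lam k - u‖ := by
      intro k hk
      have h1 := h k hk
      have h2 := norm_add_le (lam k - u) (u - z)
      rw [sub_add_sub_cancel] at h2
      linarith
    split_ifs with hk
    · refine aa_bound (half_pos hδ) (C0_ne hz₀ _) (C0_ne hz₀ _) (hsep _ (hp k hk).1)
        (hsep _ (hp k hk).2) ?_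
      have h2 := norm_add_le (u - z) (z - z₀)
      rw [sub_add_sub_cancel] at h2
      linarith
    · rw [norm_zero]; positivity
  · intro k
    split_ifs with hk
    · obtain ⟨h1, h2⟩ := hp k hk
      have : ContinuousAt (fun u => aa lam w u k) z := by
        unfold aa
        refine ContinuousAt.div (by fun_prop) (by fun_prop) ?_
        exact mul_ne_zero (sub_ne_zero.mpr h1) (sub_ne_zero.mpr h2)
      exact this.tendsto.mono_left nhdsWithin_le_nhds
    · exact tendsto_const_nhds

lemma prod_lim {lam w : ℤ → ℂ} (z : ℂ) (T : Finset ℤ) {r : ℕ}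
    (hr : r = (T.filter fun k => lam k = z).card) :
    ∃ L, Tendsto (fun u => (u - z) ^ r * ∏ k ∈ T, w (k - 1) / (u - lam k)) (𝓝[C0 lam] z) (𝓝 L) := by
  refine ⟨∏ k ∈ T, if lam k = z then w (k - 1) else w (k - 1) / (z - lam k), ?_⟩
  have e : ∀ u, (u - z) ^ r * ∏ k ∈ T, w (k - 1) / (u - lam k) =
      ∏ k ∈ T, (if lam k = z then u - z else 1) * (w (k - 1) / (u - lam k)) := by
    intro u
    rw [Finset.prod_mul_distrib, ← Finset.prod_filter, Finset.prod_const, hr]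
  simp only [e]
  refine tendsto_finsetProd _ fun k _ => ?_
  split_ifs with hk
  · refine tendsto_const_nhds.congr' ?_
    filter_upwards [self_mem_nhdsWithin] with u hu
    have : u - z ≠ 0 := by
      rw [← hk]; exact sub_ne_zero.mpr (C0_ne hu k).symm
    rw [hk]; field_simp
  · have : ContinuousAt (fun u => 1 * (w (k - 1) / (u - lam k))) z := by
      refine continuousAt_const.mul (ContinuousAt.div (by fun_prop) (by fun_prop) ?_)
      exact sub_ne_zero.mpr (Ne.symm hk)
    have h2 := this.tendsto.mono_left (nhdsWithin_le_nhds (s := C0 lam))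
    rwa [one_mul] at h2

lemma lim_down {lam w : ℤ → ℂ} (hw : ∀ n, w n ≠ 0) {z : ℂ} {f : ℂ → ℤ → ℂ} {N : ℤ}
    (hrec : ∀ u ∈ C0 lam, ∀ n, w (n - 1) * f u (n - 1) + (lam n - u) * f u n
        + w n * f u (n + 1) = 0)
    (hN : ∀ n, N ≤ n → ∃ L, Tendsto (fun u => f u n) (𝓝[C0 lam] z) (𝓝 L)) (n : ℤ) :
    ∃ L, Tendsto (fun u => f u n) (𝓝[C0 lam] z) (𝓝 L) := by
  have key : ∀ m : ℕ, ∀ n, N - m ≤ n → ∃ L, Tendsto (fun u => f u n) (𝓝[C0 lam] z) (𝓝 L) := by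
    intro m
    induction m with
    | zero => simpa using hN
    | succ m ih =>
      intro n hn
      push_cast at hn
      obtain ⟨L1, h1⟩ := ih (n + 1) (by omega)
      obtain ⟨L2, h2⟩ := ih (n + 2) (by omega)
      have hu : Tendsto (fun u : ℂ => u) (𝓝[C0 lam] z) (𝓝 z) := nhdsWithin_le_nhds
      refine ⟨_, ((((hu.const_sub (lam (n + 1))).mul h1).add
        (h2.const_mul (w (n + 1)))).const_mul (-(w n)⁻¹)).congr' ?_⟩
      filter_upwards [self_mem_nhdsWithin] with u hu
      have := hrec u hu (n + 1)
      rw [add_sub_cancel_right, show n + 1 + 1 = n + 2 by ring] at this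
      have hwn := hw n
      field_simp
      linear_combination -this
  exact key (N - n).toNat n (by omega)

lemma lim_up {lam w : ℤ → ℂ} (hw : ∀ n, w n ≠ 0) {z : ℂ} {f : ℂ → ℤ → ℂ} {N : ℤ}
    (hrec : ∀ u ∈ C0 lam, ∀ n, w (n - 1) * f u (n - 1) + (lam n - u) * f u n
        + w n * f u (n + 1) = 0)
    (hN : ∀ n, n ≤ N → ∃ L, Tendsto (fun u => f u n) (𝓝[C0 lam] z) (𝓝 L)) (n : ℤ) :
    ∃ L, Tendsto (fun u => f u n) (𝓝[C0 lam] z) (𝓝 L) := by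
  have key : ∀ m : ℕ, ∀ n, n ≤ N + m → ∃ L, Tendsto (fun u => f u n) (𝓝[C0 lam] z) (𝓝 L) := by
    intro m
    induction m with
    | zero => simpa using hN
    | succ m ih =>
      intro n hn
      push_cast at hn
      obtain ⟨L1, h1⟩ := ih (n - 1) (by omega)
      obtain ⟨L2, h2⟩ := ih (n - 1 - 1) (by omega)
      have hu : Tendsto (fun u : ℂ => u) (𝓝[C0 lam] z) (𝓝 z) := nhdsWithin_le_nhds
      refine ⟨_, ((((hu.const_sub (lam (n - 1))).mul h1).add
        (h2.const_mul (w (n - 1 - 1)))).const_mul (-(w (n - 1))⁻¹)).congr' ?_⟩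
      filter_upwards [self_mem_nhdsWithin] with u hu
      have := hrec u hu (n - 1)
      rw [sub_add_cancel] at this
      have hwn := hw (n - 1)
      field_simp
      linear_combination -this
  exact key (n - N).toNat n (by omega)

lemma exists_N {lam : ℤ → ℂ} {z : ℂ} (hz : z ∉ der lam) :
    ∃ N : ℤ, 0 ≤ N ∧ ∀ k, lam k = z → k ≤ N ∧ -N ≤ k := by
  have hf := (der_sep hz).1
  obtain ⟨a, ha⟩ := hf.bddAbove
  obtain ⟨b, hb⟩ := hf.bddBelow
  refine ⟨max 0 (max a (-b)), le_max_left _ _, fun k hk => ?_⟩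
  have h1 : k ≤ a := ha hk
  have h2 : b ≤ k := hb hk
  omega

lemma f_lim {lam w γ : ℤ → ℂ} (hw : ∀ n, w n ≠ 0) (hγ : ∀ n, γ n * γ (n + 1) = w n)
    (hconv : ConvCond lam w) {z : ℂ} (hz : z ∉ der lam) (n : ℤ) :
    ∃ L, Tendsto (fun u => (u - z) ^ rp lam z * fSol₀ lam w γ u n) (𝓝[C0 lam] z) (𝓝 L) := by
  obtain ⟨N, hN0, hN⟩ := exists_N hz
  refine lim_down (N := N) (f := fun u n => (u - z) ^ rp lam z * fSol₀ lam w γ u n) hw ?_ ?_ n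
  · intro u hu n
    linear_combination (u - z) ^ rp lam z * f_rec hw hγ hconv hu n
  · intro n hn
    have hr : rp lam z = ((Finset.Icc (1 : ℤ) n).filter fun k => lam k = z).card := by
      unfold rp
      rw [← Set.ncard_coe_finset]
      congr 1
      ext k
      simp only [Set.mem_ofPred_eq, Finset.coe_filter, Finset.mem_Icc]
      constructor
      · rintro ⟨h1, h2⟩
        have := hN k h2
        exact ⟨by omega, h2⟩
      · rintro ⟨h1, h2⟩
        exact ⟨by omega, h2⟩
    obtain ⟨L, hL⟩ := prod_lim (w := w) z _ hr
    have hG := GG_cont hconv hz (fun k => n + 1 ≤ k) (fun k hk =>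
      ⟨fun h => by have := hN _ h; omega, fun h => by have := hN _ h; omega⟩)
    refine ⟨_, (hL.mul hG).congr' ?_⟩
    filter_upwards [self_mem_nhdsWithin] with u hu
    rw [fSol₀, Fplus_eq hγ (summable_if (summable_aa hconv hu) _), Pz, if_pos (by omega), mul_assoc]

lemma g_lim {lam w γ : ℤ → ℂ} (hw : ∀ n, w n ≠ 0) (hγ : ∀ n, γ n * γ (n + 1) = w n)
    (hconv : ConvCond lam w) {z : ℂ} (hz : z ∉ der lam) (n : ℤ) :
    ∃ L, Tendsto (fun u => (u - z) ^ rm lam z * gSol₀ lam w γ u n) (𝓝[C0 lam] z) (𝓝 L) := by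
  obtain ⟨N, hN0, hN⟩ := exists_N hz
  refine lim_up (N := -N) (f := fun u n => (u - z) ^ rm lam z * gSol₀ lam w γ u n) hw ?_ ?_ n
  · intro u hu n
    linear_combination (u - z) ^ rm lam z * g_rec hw hγ hconv hu n
  · intro n hn
    have hr : rm lam z = ((Finset.Icc n (0 : ℤ)).filter fun k => lam k = z).card := by
      unfold rm
      rw [← Set.ncard_coe_finset]
      congr 1
      ext k
      simp only [Set.mem_ofPred_eq, Finset.coe_filter, Finset.mem_Icc]
      constructor
      · rintro ⟨h1, h2⟩
        have := hN k h2
        exact ⟨by omega, h2⟩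
      · rintro ⟨h1, h2⟩
        exact ⟨by omega, h2⟩
    obtain ⟨L, hL⟩ := prod_lim (w := w) z _ hr
    have hG := GG_cont hconv hz (fun k => k + 1 ≤ n - 1) (fun k hk =>
      ⟨fun h => by have := hN _ h; omega, fun h => by have := hN _ h; omega⟩)
    refine ⟨_, ((hL.const_mul (w (n - 1))⁻¹).mul hG).congr' ?_⟩
    filter_upwards [self_mem_nhdsWithin] with u hu
    rw [gSol₀, Fminus_eq hγ (summable_if (summable_aa hconv hu) _), Pz, if_neg (by omega),
      sub_add_cancel, mul_inv, ← Finset.prod_inv_distrib]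
    simp only [inv_div]
    ring

lemma fSol_lim {lam w γ : ℤ → ℂ} (hw : ∀ n, w n ≠ 0) (hγ : ∀ n, γ n * γ (n + 1) = w n)
    (hconv : ConvCond lam w) {z : ℂ} (hz : z ∉ der lam) (n : ℤ) :
    Tendsto (fun u => (u - z) ^ rp lam z * fSol₀ lam w γ u n) (𝓝[C0 lam] z)
      (𝓝 (fSol lam w γ z n)) := by
  have := neBot_C0 hz
  have h := f_lim hw hγ hconv hz n
  unfold fSol
  split_ifs with hC
  · obtain ⟨L, hL⟩ := h
    have h0 : rp lam z = 0 := by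
      have : {n : ℤ | 0 < n ∧ lam n = z} = ∅ := by
        ext k; simp [C0_ne hC k]
      rw [rp, this, Set.ncard_empty]
    have := tendsto_nhds_unique (hL.mono_left (pure_le_nhdsWithin hC)) (tendsto_pure_nhds _ z)
    rw [this] at hL
    simpa [h0] using hL
  · exact tendsto_nhds_limUnder h

lemma gSol_lim {lam w γ : ℤ → ℂ} (hw : ∀ n, w n ≠ 0) (hγ : ∀ n, γ n * γ (n + 1) = w n)
    (hconv : ConvCond lam w) {z : ℂ} (hz : z ∉ der lam) (n : ℤ) :
    Tendsto (fun u => (u - z) ^ rm lam z * gSol₀ lam w γ u n) (𝓝[C0 lam] z)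
      (𝓝 (gSol lam w γ z n)) := by
  have := neBot_C0 hz
  have h := g_lim hw hγ hconv hz n
  unfold gSol
  split_ifs with hC
  · obtain ⟨L, hL⟩ := h
    have h0 : rm lam z = 0 := by
      have : {n : ℤ | n ≤ 0 ∧ lam n = z} = ∅ := by
        ext k; simp [C0_ne hC k]
      rw [rm, this, Set.ncard_empty]
    have := tendsto_nhds_unique (hL.mono_left (pure_le_nhdsWithin hC)) (tendsto_pure_nhds _ z)
    rw [this] at hL
    simpa [h0] using hL
  · exact tendsto_nhds_limUnder h

lemma rz_eq {lam : ℤ → ℂ} {z : ℂ} (hz : z ∉ der lam) : rz lam z = rp lam z + rm lam z := by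
  have hf := (der_sep hz).1
  unfold rz rp rm
  have f1 : {n : ℤ | 0 < n ∧ lam n = z}.Finite := hf.subset fun k hk => hk.2
  have f2 : {n : ℤ | n ≤ 0 ∧ lam n = z}.Finite := hf.subset fun k hk => hk.2
  rw [← Set.ncard_union_eq _ f1 f2]
  · congr 1
    ext k
    simp only [Set.mem_ofPred_eq, Set.mem_union]
    have := lt_or_ge 0 k
    tauto
  · rw [Set.disjoint_left]
    rintro k ⟨h1, -⟩ ⟨h2, -⟩
    omega

lemma rec_lim {lam w : ℤ → ℂ} {z : ℂ} (hz : z ∉ der lam) {f : ℂ → ℤ → ℂ} {L : ℤ → ℂ}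
    (hrec : ∀ u ∈ C0 lam, ∀ n, w (n - 1) * f u (n - 1) + (lam n - u) * f u n
        + w n * f u (n + 1) = 0)
    (hL : ∀ n, Tendsto (fun u => f u n) (𝓝[C0 lam] z) (𝓝 (L n))) (n : ℤ) :
    w (n - 1) * L (n - 1) + (lam n - z) * L n + w n * L (n + 1) = 0 := by
  have := neBot_C0 hz
  have hu : Tendsto (fun u : ℂ => u) (𝓝[C0 lam] z) (𝓝 z) := nhdsWithin_le_nhds
  have h1 := (((hL (n - 1)).const_mul (w (n - 1))).add
    ((hu.const_sub (lam n)).mul (hL n))).add ((hL (n + 1)).const_mul (w n))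
  refine tendsto_nhds_unique h1 (tendsto_const_nhds.congr' ?_)
  filter_upwards [self_mem_nhdsWithin] with u hu
  exact (hrec u hu n).symm

end Jacobi

/-- `f(z)` and `g(z)` solve the eigenvalue equation `𝒥u = zu`, and their
Wronskian (independent of `n`) equals `lim_{u→z} (u−z)^{r(z)} F_𝒥(u)`. -/
theorem statement2 (lam w γ : ℤ → ℂ) (hw : ∀ n, w n ≠ 0)
    (hγ : ∀ n, γ n * γ (n + 1) = w n) (hconv : Jacobi.ConvCond lam w)
    (z : ℂ) (hz : z ∉ Jacobi.der lam) :
    (∀ n : ℤ, w (n - 1) * Jacobi.fSol lam w γ z (n - 1) + (lam n - z) * Jacobi.fSol lam w γ z n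
        + w n * Jacobi.fSol lam w γ z (n + 1) = 0) ∧
    (∀ n : ℤ, w (n - 1) * Jacobi.gSol lam w γ z (n - 1) + (lam n - z) * Jacobi.gSol lam w γ z n
        + w n * Jacobi.gSol lam w γ z (n + 1) = 0) ∧
    ∀ n : ℤ,
      Tendsto (fun u : ℂ => (u - z) ^ Jacobi.rz lam z * Jacobi.charF lam γ u)
        (𝓝[Jacobi.C0 lam] z)
        (𝓝 (w n * (Jacobi.fSol lam w γ z n * Jacobi.gSol lam w γ z (n + 1) -
          Jacobi.fSol lam w γ z (n + 1) * Jacobi.gSol lam w γ z n))) := by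
  refine ⟨?_, ?_, ?_⟩
  · refine Jacobi.rec_lim hz (f := fun u n => (u - z) ^ Jacobi.rp lam z *
      Jacobi.fSol₀ lam w γ u n) ?_ (Jacobi.fSol_lim hw hγ hconv hz)
    intro u hu n
    linear_combination (u - z) ^ Jacobi.rp lam z * Jacobi.f_rec hw hγ hconv hu n
  · refine Jacobi.rec_lim hz (f := fun u n => (u - z) ^ Jacobi.rm lam z *
      Jacobi.gSol₀ lam w γ u n) ?_ (Jacobi.gSol_lim hw hγ hconv hz)
    intro u hu n
    linear_combination (u - z) ^ Jacobi.rm lam z * Jacobi.g_rec hw hγ hconv hu n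
  · intro n
    have hf := Jacobi.fSol_lim hw hγ hconv hz
    have hg := Jacobi.gSol_lim hw hγ hconv hz
    refine ((((hf n).mul (hg (n + 1))).sub ((hf (n + 1)).mul (hg n))).const_mul (w n)).congr' ?_
    filter_upwards [self_mem_nhdsWithin] with u hu
    rw [Jacobi.rz_eq hz, pow_add, ← Jacobi.wr₀ hw hγ hconv hu n]
    ring

end
end

section
/- Under the convergence condition, every z ∈ 𝔷(𝒥) is an eigenvalue of J_max with eigenvector f(z); that is, for z ∈ ℂ∖der(λ) with lim_{u→z} (u−z)^{r(z)} F_𝒥(u) = 0, the sequence f(z) satisfies f(z) ∈ ℓ²(ℤ), f(z) ≠ 0, and 𝒥 f(z) = z f(z). In particular 𝔷(𝒥) ⊆ spec_p(J_max) ∖ der(λ). -/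
open Filter Topology
open scoped Classical

noncomputable section

namespace JacobiAux

open Jacobi

/-- Finite sets of integers without two consecutive elements. -/
def Sparse (S : Finset ℤ) : Prop := ∀ k ∈ S, k + 1 ∉ S

/-- The summand of the sparse-set expansion. -/
def TT (a : ℤ → ℂ) (S : Finset ℤ) : ℂ := if Sparse S then ∏ k ∈ S, a k else 0

/-- The sparse-set expansion of `𝔉`. -/
def GG (a : ℤ → ℂ) : ℂ := ∑' S : Finset ℤ, TT a S

lemma norm_TT_le (a : ℤ → ℂ) (b : ℤ → ℝ) (hab : ∀ k, ‖a k‖ ≤ b k) (S : Finset ℤ) :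
    ‖TT a S‖ ≤ ∏ k ∈ S, b k := by
  unfold TT
  split_ifs
  · rw [norm_prod]
    exact Finset.prod_le_prod (fun _ _ => norm_nonneg _) (fun k _ => hab k)
  · rw [norm_zero]
    exact Finset.prod_nonneg (fun k _ => (norm_nonneg _).trans (hab k))

lemma summable_bound (b : ℤ → ℝ) (h0 : ∀ k, 0 ≤ b k) (hb : Summable b) :
    Summable (fun S : Finset ℤ => ∏ k ∈ S, b k) :=
  summable_finsetProd_of_summable_nonneg h0 hb

lemma summable_TT (a : ℤ → ℂ) (ha : Summable fun k => ‖a k‖) : Summable (TT a) :=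
  Summable.of_norm_bounded (summable_bound _ (fun _ => norm_nonneg _) ha)
    (norm_TT_le a _ (fun _ => le_rfl))

lemma tendsto_GG {ι : Type*} {l : Filter ι} (a : ι → ℤ → ℂ) (c : ℤ → ℂ) (b : ℤ → ℝ)
    (h0 : ∀ k, 0 ≤ b k) (hb : Summable b) (hab : ∀ᶠ i in l, ∀ k, ‖a i k‖ ≤ b k)
    (hlim : ∀ k, Tendsto (fun i => a i k) l (𝓝 (c k))) :
    Tendsto (fun i => GG (a i)) l (𝓝 (GG c)) := by
  unfold GG
  refine tendsto_tsum_of_dominated_convergence (summable_bound b h0 hb) ?_ ?_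
  · intro S
    unfold TT
    split_ifs
    · exact tendsto_finsetProd _ (fun k _ => hlim k)
    · exact tendsto_const_nhds
  · filter_upwards [hab] with i hi S
    exact norm_TT_le _ _ hi S

lemma GG_zero : GG (fun _ => 0) = 1 := by
  unfold GG
  rw [tsum_eq_single ∅]
  · simp [TT, Sparse]
  · intro S hS
    unfold TT
    split_ifs
    · obtain ⟨k, hk⟩ := Finset.nonempty_iff_ne_empty.mpr hS
      exact Finset.prod_eq_zero hk rfl
    · rfl

/-- Truncation from below. -/
def cut (n : ℤ) (a : ℤ → ℂ) : ℤ → ℂ := fun k => if n ≤ k then a k else 0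

lemma norm_cut_le (n : ℤ) (a : ℤ → ℂ) (k : ℤ) : ‖cut n a k‖ ≤ ‖a k‖ := by
  unfold cut; split_ifs <;> simp

lemma summable_cut (n : ℤ) (a : ℤ → ℂ) (ha : Summable fun k => ‖a k‖) :
    Summable fun k => ‖cut n a k‖ :=
  Summable.of_nonneg_of_le (fun _ => norm_nonneg _) (norm_cut_le n a) ha

lemma tendsto_cut_top (a : ℤ → ℂ) (ha : Summable fun k => ‖a k‖) :
    Tendsto (fun n : ℤ => GG (cut n a)) atTop (𝓝 1) := by
  rw [← GG_zero]
  refine tendsto_GG _ _ _ (fun _ => norm_nonneg _) ha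
    (Eventually.of_forall fun n k => norm_cut_le n a k) ?_
  intro k
  refine tendsto_const_nhds.congr' ?_
  filter_upwards [eventually_gt_atTop k] with n hn
  simp [cut, hn]

lemma tendsto_cut_bot (a : ℤ → ℂ) (ha : Summable fun k => ‖a k‖) :
    Tendsto (fun n : ℤ => GG (cut n a)) atBot (𝓝 (GG a)) := by
  refine tendsto_GG _ _ _ (fun _ => norm_nonneg _) ha
    (Eventually.of_forall fun n k => norm_cut_le n a k) ?_
  intro k
  refine tendsto_const_nhds.congr' ?_
  filter_upwards [eventually_le_atBot k] with n hn
  simp [cut, hn]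

/-- Toggling the membership of `n`. -/
def toggle (n : ℤ) : Finset ℤ ≃ Finset ℤ where
  toFun S := symmDiff S {n}
  invFun S := symmDiff S {n}
  left_inv S := by simp
  right_inv S := by simp

lemma TT_cut_eq_zero (n : ℤ) (a : ℤ → ℂ) (S : Finset ℤ) (k : ℤ) (hk : k ∈ S) (hkn : k < n) :
    TT (cut n a) S = 0 := by
  unfold TT
  split_ifs
  · refine Finset.prod_eq_zero hk ?_
    simp [cut, hkn]
  · rfl

lemma TT_cut_congr (n m : ℤ) (a : ℤ → ℂ) (S : Finset ℤ) (h : ∀ k ∈ S, n ≤ k ↔ m ≤ k) :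
    TT (cut n a) S = TT (cut m a) S := by
  unfold TT
  split_ifs
  · refine Finset.prod_congr rfl fun k hk => ?_
    simp only [cut, h k hk]
  · rfl

lemma TT_split (n : ℤ) (a : ℤ → ℂ) (S : Finset ℤ) :
    TT (cut n a) S = TT (cut (n + 1) a) S +
      (if n ∈ S then a n * TT (cut (n + 2) a) (S.erase n) else 0) := by
  split_ifs with hn
  · rw [TT_cut_eq_zero (n + 1) a S n hn (by omega), zero_add]
    by_cases hlow : ∃ k ∈ S, k < n
    · obtain ⟨k, hk, hkn⟩ := hlow
      rw [TT_cut_eq_zero n a S k hk hkn,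
        TT_cut_eq_zero (n + 2) a (S.erase n) k (Finset.mem_erase.mpr ⟨by omega, hk⟩) (by omega),
        mul_zero]
    · push Not at hlow
      by_cases hn1 : n + 1 ∈ S
      · rw [TT_cut_eq_zero (n + 2) a (S.erase n) (n + 1)
          (Finset.mem_erase.mpr ⟨by omega, hn1⟩) (by omega), mul_zero]
        unfold TT
        rw [if_neg]
        intro h
        exact h n hn hn1
      · have hsp : Sparse (S.erase n) ↔ Sparse S := by
          constructor
          · intro h k hk hk1
            by_cases hkn : k = n
            · subst hkn; exact hn1 hk1
            · have := hlow k hk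
              exact h k (Finset.mem_erase.mpr ⟨hkn, hk⟩)
                (Finset.mem_erase.mpr ⟨by omega, hk1⟩)
          · intro h k hk hk1
            exact h k (Finset.mem_of_mem_erase hk) (Finset.mem_of_mem_erase hk1)
        rw [TT_cut_congr (n + 2) n a (S.erase n)]
        · unfold TT
          simp only [hsp]
          split_ifs
          · rw [← Finset.mul_prod_erase S _ hn]
            simp [cut]
          · simp
        · intro k hk
          have h1 := Finset.mem_erase.mp hk
          have h2 := hlow k h1.2
          have h3 : k ≠ n + 1 := fun h => hn1 (h ▸ h1.2)
          have h4 := h1.1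
          omega
  · rw [add_zero]
    apply TT_cut_congr
    intro k hk
    have : k ≠ n := fun h => hn (h ▸ hk)
    omega

lemma GG_rec (n : ℤ) (a : ℤ → ℂ) (ha : Summable fun k => ‖a k‖) :
    GG (cut n a) = GG (cut (n + 1) a) + a n * GG (cut (n + 2) a) := by
  have key : ∀ S, (fun S : Finset ℤ =>
      (if n ∈ S then a n * TT (cut (n + 2) a) (S.erase n) else 0)) (toggle n S)
      = a n * TT (cut (n + 2) a) S := by
    intro S
    by_cases hn : n ∈ S
    · have : n ∉ toggle n S := by simp [toggle, Finset.mem_symmDiff, hn]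
      simp only [this, if_false]
      rw [TT_cut_eq_zero (n + 2) a S n hn (by omega), mul_zero]
    · have h1 : n ∈ toggle n S := by simp [toggle, Finset.mem_symmDiff, hn]
      simp only [h1, if_true]
      congr 2
      ext k
      by_cases hk : k = n
      · subst hk; simp [hn]
      · simp [toggle, Finset.mem_symmDiff, hk]
  have hs : Summable fun S : Finset ℤ =>
      (if n ∈ S then a n * TT (cut (n + 2) a) (S.erase n) else 0) := by
    rw [← (toggle n).summable_iff]
    refine Summable.congr ((summable_TT _ (summable_cut (n + 2) a ha)).mul_left (a n)) ?_
    intro S; exact (key S).symm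
  unfold GG
  rw [tsum_congr (TT_split n a), (summable_TT _ (summable_cut (n + 1) a ha)).tsum_add hs,
    ← tsum_mul_left]
  congr 1
  rw [← (toggle n).tsum_eq (fun S : Finset ℤ =>
    (if n ∈ S then a n * TT (cut (n + 2) a) (S.erase n) else 0))]
  exact tsum_congr key

lemma GG_reflect (a : ℤ → ℂ) : GG (fun k => a (-k - 1)) = GG a := by
  let e : ℤ ≃ ℤ :=
    { toFun := fun k => -k - 1
      invFun := fun k => -k - 1
      left_inv := fun k => by ring
      right_inv := fun k => by ring }
  unfold GG
  rw [← (e.finsetCongr).tsum_eq]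
  refine tsum_congr fun S => ?_
  have hsp : Sparse (e.finsetCongr S) ↔ Sparse S := by
    simp only [Equiv.finsetCongr_apply, Sparse, Finset.mem_map_equiv]
    constructor
    · intro h k hk hk1
      refine h (-(k+1) - 1) ?_ ?_
      · simpa [e] using hk1
      · simpa [e] using hk
    · intro h k hk hk1
      refine h (-(k+1) - 1) ?_ ?_
      · simpa [e] using hk1
      · convert hk using 1; simp [e]; ring
  unfold TT
  simp only [hsp]
  split_ifs
  · simp [e]
  · rfl

lemma tup_gap {m : ℕ} (k : Tup m) {i j : Fin (m + 1)} (hij : i < j) : k.1 i + 2 ≤ k.1 j := by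
  have hmono : StrictMono k.1 := by
    rw [Fin.strictMono_iff_lt_succ]
    intro i
    have := k.2 i
    omega
  have hi : i.val < m := by have := hij; have := j.2; omega
  have h1 := k.2 ⟨i.val, hi⟩
  have h2 : k.1 (Fin.succ ⟨i.val, hi⟩) ≤ k.1 j := by
    apply hmono.monotone
    rw [Fin.le_def]
    simp
    omega
  have h3 : (Fin.castSucc ⟨i.val, hi⟩ : Fin (m + 1)) = i := by ext; simp
  rw [h3] at h1
  omega

lemma tup_mono {m : ℕ} (k : Tup m) : StrictMono k.1 := by
  intro i j hij
  have := tup_gap k hij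
  omega

/-- The finite set associated with an admissible tuple. -/
def tupSet (p : Σ m, Tup m) : Finset ℤ := Finset.univ.image p.2.1

lemma tupSet_inj : Function.Injective tupSet := by
  rintro ⟨m, k⟩ ⟨m₂, k₂⟩ h
  have hc : ∀ (m : ℕ) (k : Tup m), (tupSet ⟨m, k⟩).card = m + 1 := by
    intro m k
    simp [tupSet, Finset.card_image_of_injective _ (tup_mono k).injective]
  have h1 := hc m k
  have h2 := hc m₂ k₂
  rw [h, h2] at h1
  obtain rfl : m₂ = m := by omega
  congr 1
  apply Subtype.ext
  rw [← (tup_mono k).range_inj (tup_mono k₂)]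
  have := congrArg (fun S : Finset ℤ => (S : Set ℤ)) h
  simpa [tupSet] using this

lemma tupSet_sparse (p : Σ m, Tup m) : Sparse (tupSet p) := by
  obtain ⟨m, k⟩ := p
  intro a ha ha1
  simp only [tupSet, Finset.mem_image, Finset.mem_univ, true_and] at ha ha1
  obtain ⟨i, rfl⟩ := ha
  obtain ⟨j, hj⟩ := ha1
  rcases lt_trichotomy i j with h | h | h
  · have := tup_gap k h; omega
  · subst h; omega
  · have := tup_gap k h; omega

lemma tupSet_surj (S : Finset ℤ) (hS : Sparse S) (hne : S ≠ ∅) : ∃ p, tupSet p = S := by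
  obtain ⟨m, hm⟩ : ∃ m, S.card = m + 1 :=
    ⟨S.card - 1, by have := Finset.card_pos.mpr (Finset.nonempty_iff_ne_empty.mpr hne); omega⟩
  refine ⟨⟨m, ⟨S.orderEmbOfFin hm, ?_⟩⟩, ?_⟩
  · intro j
    have h1 : S.orderEmbOfFin hm j.castSucc < S.orderEmbOfFin hm j.succ :=
      (S.orderEmbOfFin hm).strictMono (Fin.castSucc_lt_succ)
    have h2 := hS _ (S.orderEmbOfFin_mem hm j.castSucc)
    have h3 := S.orderEmbOfFin_mem hm j.succ
    have h4 : S.orderEmbOfFin hm j.castSucc + 1 ≠ S.orderEmbOfFin hm j.succ := by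
      intro h; rw [h] at h2; exact h2 h3
    omega
  · ext x
    have := S.range_orderEmbOfFin hm
    have h2 := Set.ext_iff.mp this x
    simpa [tupSet] using h2

lemma FF_eq (x : ℤ → ℂ) (hx : Summable fun k => ‖x k * x (k + 1)‖) :
    FF x = GG (fun k => -(x k * x (k + 1))) := by
  set a : ℤ → ℂ := fun k => -(x k * x (k + 1)) with ha
  have hs : Summable (TT a) := summable_TT a (by simpa [ha] using hx)
  have hterm : ∀ p : Σ m, Tup m, TT a (tupSet p) =
      (-1 : ℂ) ^ (p.1 + 1) * ∏ j, x (p.2.1 j) * x (p.2.1 j + 1) := by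
    intro p
    unfold TT
    rw [if_pos (tupSet_sparse p)]
    unfold tupSet
    rw [Finset.prod_image (fun i _ j _ h => (tup_mono p.2).injective h)]
    simp only [ha, Finset.prod_neg, Finset.card_univ, Fintype.card_fin]
  have hsum : Summable fun p : Σ m, Tup m => TT a (tupSet p) := hs.comp_injective tupSet_inj
  have h1 : GG a = 1 + ∑' p : Σ m, Tup m, TT a (tupSet p) := by
    unfold GG
    rw [hs.tsum_eq_add_tsum_ite ∅]
    congr 1
    · simp [TT, Sparse]
    · rw [← tupSet_inj.tsum_eq]
      · refine tsum_congr fun p => ?_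
        rw [if_neg]
        intro h
        have : p.2.1 0 ∈ tupSet p := by simp [tupSet]
        rw [h] at this
        simp at this
      · intro S hS
        rw [Function.mem_support] at hS
        have hne : S ≠ ∅ := by
          rintro rfl; simp at hS
        have hsp : Sparse S := by
          by_contra hsp
          apply hS
          simp [TT, hsp]
        exact tupSet_surj S hsp hne
  rw [h1, hsum.tsum_sigma]
  unfold FF
  congr 1
  refine tsum_congr fun m => ?_
  rw [← tsum_mul_left]
  exact tsum_congr fun k => (hterm ⟨m, k⟩).symm

end JacobiAux
namespace JacobiAux

open Jacobi

/-- The basic weights. -/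
def dd (lam w : ℤ → ℂ) (u : ℂ) (k : ℤ) : ℂ := -(w k ^ 2 / ((lam k - u) * (lam (k + 1) - u)))

/-- The solution `f` in terms of the sparse-set expansion. -/
def f0 (lam w : ℤ → ℂ) (u : ℂ) (n : ℤ) : ℂ := Pz lam w u n * GG (cut (n + 1) (dd lam w u))

/-- `z` is separated from the values of `lam` different from `z`. -/
def Sep (lam : ℤ → ℂ) (z : ℂ) : Prop := ∃ δ > 0, ∀ k, lam k ≠ z → δ ≤ ‖lam k - z‖

lemma sep_of_C0 {lam : ℤ → ℂ} {u : ℂ} (hu : u ∈ C0 lam) :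
    Sep lam u ∧ ∀ k, lam k ≠ u := by
  have h : (closure (Set.range lam))ᶜ ∈ 𝓝 u := isClosed_closure.isOpen_compl.mem_nhds hu
  obtain ⟨δ, hδ, hb⟩ := Metric.mem_nhds_iff.mp h
  have hk : ∀ k, δ ≤ ‖lam k - u‖ := by
    intro k
    by_contra hlt
    push Not at hlt
    exact hb (mem_ball_iff_norm.mpr hlt) (subset_closure ⟨k, rfl⟩)
  refine ⟨⟨δ, hδ, fun k _ => hk k⟩, fun k h => ?_⟩
  have := hk k
  simp [h] at this
  linarith

lemma sep_of_not_der {lam : ℤ → ℂ} {z : ℂ} (hz : z ∉ der lam) :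
    Sep lam z ∧ {k | lam k = z}.Finite := by
  simp only [der, Set.mem_setOf_eq, mapClusterPt_iff_frequently] at hz
  push Not at hz
  obtain ⟨s, hs, hfin⟩ := hz
  rw [Filter.eventually_cofinite] at hfin
  simp only [not_not] at hfin
  refine ⟨?_, hfin.subset fun k hk => ?_⟩
  · have hA : (lam '' {k | lam k ∈ s} \ {z}).Finite := (hfin.image lam).diff
    have h2 : (lam '' {k | lam k ∈ s} \ {z})ᶜ ∈ 𝓝 z :=
      hA.isClosed.isOpen_compl.mem_nhds (by simp)
    obtain ⟨δ, hδ, hb⟩ := Metric.mem_nhds_iff.mp (inter_mem hs h2)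
    refine ⟨δ, hδ, fun k hk => ?_⟩
    by_contra hlt
    push Not at hlt
    have := hb (mem_ball_iff_norm.mpr hlt)
    exact this.2 ⟨⟨k, this.1, rfl⟩, hk⟩
  · simp only [Set.mem_setOf_eq] at hk ⊢
    rw [hk]; exact mem_of_mem_nhds hs

lemma C0_mem_nhdsNE {lam : ℤ → ℂ} {z : ℂ} (hz : Sep lam z) : 𝓝[≠] z ≤ 𝓝[C0 lam] z := by
  obtain ⟨δ, hδ, hk⟩ := hz
  rw [nhdsWithin, nhdsWithin]
  refine le_inf inf_le_left ?_
  rw [le_principal_iff, ← nhdsWithin, mem_nhdsWithin]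
  refine ⟨Metric.ball z δ, Metric.isOpen_ball, Metric.mem_ball_self hδ, ?_⟩
  rintro u ⟨hu, hne⟩
  rw [mem_ball_iff_norm] at hu
  have hpos : 0 < ‖u - z‖ := norm_pos_iff.mpr (sub_ne_zero.mpr hne)
  intro hcl
  rw [Metric.mem_closure_iff] at hcl
  obtain ⟨_, ⟨k, rfl⟩, hd⟩ := hcl (min ‖u - z‖ (δ - ‖u - z‖)) (lt_min hpos (by linarith))
  rw [dist_eq_norm] at hd
  obtain ⟨h1, h2⟩ := lt_min_iff.mp hd
  by_cases hkz : lam k = z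
  · rw [hkz] at h1; linarith
  · have h3 := hk k hkz
    have h4 : ‖lam k - z‖ ≤ ‖u - lam k‖ + ‖u - z‖ := by
      have : lam k - z = -(u - lam k) + (u - z) := by ring
      rw [this]
      exact (norm_add_le _ _).trans (by rw [norm_neg])
    linarith

lemma neBot_C0 {lam : ℤ → ℂ} {z : ℂ} (hz : Sep lam z) : (𝓝[C0 lam] z).NeBot :=
  neBot_of_le (C0_mem_nhdsNE hz)

lemma summable_dd {lam w : ℤ → ℂ} (hconv : ConvCond lam w) {z : ℂ} (hz : Sep lam z) :
    Summable fun k => ‖dd lam w z k‖ := by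
  obtain ⟨z₀, hz₀, hs⟩ := hconv
  obtain ⟨δ, hδ, hk⟩ := hz
  obtain ⟨-, hne⟩ := sep_of_C0 hz₀
  set C : ℝ := 1 + ‖z - z₀‖ / δ with hC
  have hC0 : 0 ≤ C := by positivity
  have hb : ∀ k, ‖(lam k - z)⁻¹‖ ≤ C * ‖(lam k - z₀)⁻¹‖ := by
    intro k
    by_cases h : lam k = z
    · rw [h]; simp; positivity
    · have h1 := hk k h
      have hpos : 0 < ‖lam k - z‖ := hδ.trans_le h1
      have hpos0 : 0 < ‖lam k - z₀‖ := norm_pos_iff.mpr (sub_ne_zero.mpr (hne k))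
      rw [norm_inv, norm_inv, ← div_eq_mul_inv, le_div_iff₀ hpos0, inv_mul_le_iff₀ hpos]
      have h2 : ‖lam k - z₀‖ ≤ ‖lam k - z‖ + ‖z - z₀‖ := by
        have : lam k - z₀ = (lam k - z) + (z - z₀) := by ring
        rw [this]; exact norm_add_le _ _
      have h3 : ‖z - z₀‖ ≤ ‖z - z₀‖ / δ * ‖lam k - z‖ := by
        rw [div_mul_eq_mul_div, le_div_iff₀ hδ]
        exact mul_le_mul_of_nonneg_left h1 (norm_nonneg _)
      rw [hC]; linarith
  refine Summable.of_nonneg_of_le (fun _ => norm_nonneg _) (fun k => ?_) (hs.mul_left (C * C))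
  have e : ∀ v, ‖w k ^ 2 / ((lam k - v) * (lam (k + 1) - v))‖
      = ‖w k ^ 2‖ * (‖(lam k - v)⁻¹‖ * ‖(lam (k + 1) - v)⁻¹‖) := by
    intro v
    rw [div_eq_mul_inv, mul_inv, norm_mul, norm_mul]
  unfold dd
  rw [norm_neg, e, e]
  have h5 := mul_le_mul (hb k) (hb (k + 1)) (norm_nonneg _) (by positivity)
  calc _ ≤ ‖w k ^ 2‖ * (C * ‖(lam k - z₀)⁻¹‖ * (C * ‖(lam (k + 1) - z₀)⁻¹‖)) :=
        mul_le_mul_of_nonneg_left h5 (norm_nonneg _)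
    _ = _ := by ring

lemma Pz_rec (lam w : ℤ → ℂ) (hw : ∀ n, w n ≠ 0) (u : ℂ) (hu : ∀ k, lam k ≠ u) (n : ℤ) :
    Pz lam w u n = Pz lam w u (n - 1) * (w (n - 1) / (u - lam n)) := by
  have hne : u - lam n ≠ 0 := sub_ne_zero.mpr (hu n).symm
  unfold Pz
  rcases lt_trichotomy n 0 with h | h | h
  · rw [if_neg (by omega), if_neg (by omega)]
    have : Finset.Icc (n - 1 + 1) (0 : ℤ) = insert n (Finset.Icc (n + 1) 0) := by
      ext k; simp only [Finset.mem_Icc, Finset.mem_insert]; omega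
    rw [this, Finset.prod_insert (by simp)]
    have := hw (n - 1)
    field_simp
  · subst h
    have := hw (-1)
    simp
    field_simp
  · rw [if_pos (by omega), if_pos (by omega)]
    have : Finset.Icc (1 : ℤ) n = insert n (Finset.Icc 1 (n - 1)) := by
      ext k; simp only [Finset.mem_Icc, Finset.mem_insert]; omega
    rw [this, Finset.prod_insert (by simp), mul_comm]

lemma f0_rec (lam w : ℤ → ℂ) (hw : ∀ n, w n ≠ 0) (hconv : ConvCond lam w) (u : ℂ)
    (hu : u ∈ C0 lam) (n : ℤ) :
    w (n - 1) * f0 lam w u (n - 1) + lam n * f0 lam w u n + w n * f0 lam w u (n + 1)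
      = u * f0 lam w u n := by
  obtain ⟨hsep, hne⟩ := sep_of_C0 hu
  have h1 := GG_rec n (dd lam w u) (summable_dd hconv hsep)
  have h2 := Pz_rec lam w hw u hne n
  have h3 := Pz_rec lam w hw u hne (n + 1)
  have e1 : u - lam n ≠ 0 := sub_ne_zero.mpr (hne n).symm
  have e2 : u - lam (n + 1) ≠ 0 := sub_ne_zero.mpr (hne (n + 1)).symm
  have h4 : dd lam w u n = -(w n ^ 2 / ((u - lam n) * (u - lam (n + 1)))) := by
    unfold dd
    congr 2
    ring
  rw [h4] at h1
  unfold f0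
  rw [show n + 1 - 1 = n by ring] at h3
  rw [show n - 1 + 1 = n by ring, show n + 1 + 1 = n + 2 by ring, h1, h3, h2]
  generalize GG (cut (n + 1) (dd lam w u)) = A
  generalize GG (cut (n + 2) (dd lam w u)) = B
  generalize Pz lam w u (n - 1) = P
  field_simp
  ring

/-- The regularised version of `Pz` to the right of zero. -/
def QQ (lam w : ℤ → ℂ) (z : ℂ) (n : ℤ) : ℂ :=
  ∏ k ∈ Finset.Icc (1 : ℤ) n, w (k - 1) / (if lam k = z then 1 else z - lam k)

lemma QQ_ne (lam w : ℤ → ℂ) (hw : ∀ n, w n ≠ 0) (z : ℂ) (n : ℤ) : QQ lam w z n ≠ 0 := by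
  unfold QQ
  refine Finset.prod_ne_zero_iff.mpr fun k _ => div_ne_zero (hw _) ?_
  split_ifs with h
  · exact one_ne_zero
  · exact sub_ne_zero.mpr (Ne.symm h)

lemma QQ_succ (lam w : ℤ → ℂ) (z : ℂ) (n : ℤ) (hn : 0 ≤ n) (hz : lam (n + 1) ≠ z) :
    QQ lam w z (n + 1) = QQ lam w z n * (w n / (z - lam (n + 1))) := by
  unfold QQ
  have : Finset.Icc (1 : ℤ) (n + 1) = insert (n + 1) (Finset.Icc 1 n) := by
    ext k; simp only [Finset.mem_Icc, Finset.mem_insert]; omega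
  rw [this, Finset.prod_insert (by simp), mul_comm, if_neg hz]
  simp

lemma tendsto_QQ (lam w : ℤ → ℂ) (z : ℂ) (N : ℤ) (hN0 : 0 ≤ N)
    (hN : ∀ k, N < k → lam k ≠ z) (n : ℤ) (hn : N ≤ n) :
    Tendsto (fun u => (u - z) ^ rp lam z * Pz lam w u n) (𝓝[C0 lam] z) (𝓝 (QQ lam w z n)) := by
  have hr : rp lam z = ((Finset.Icc (1 : ℤ) n).filter fun k => lam k = z).card := by
    unfold rp
    rw [← Set.ncard_coe_finset]
    congr 1
    ext k
    simp only [Set.mem_setOf_eq, Finset.coe_filter, Finset.mem_Icc]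
    constructor
    · rintro ⟨h1, h2⟩
      refine ⟨⟨by omega, ?_⟩, h2⟩
      by_contra h3
      exact hN k (by omega) h2
    · rintro ⟨⟨h1, _⟩, h2⟩
      exact ⟨by omega, h2⟩
  have hlim : Tendsto (fun u => ∏ k ∈ Finset.Icc (1 : ℤ) n,
      w (k - 1) / (if lam k = z then 1 else u - lam k)) (𝓝[C0 lam] z) (𝓝 (QQ lam w z n)) := by
    unfold QQ
    refine tendsto_finsetProd _ fun k _ => ?_
    split_ifs with h
    · exact tendsto_const_nhds
    · refine Tendsto.div tendsto_const_nhds ?_ (sub_ne_zero.mpr (Ne.symm h))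
      exact (Tendsto.sub_const tendsto_id _).mono_left nhdsWithin_le_nhds
  refine hlim.congr' ?_
  filter_upwards [self_mem_nhdsWithin] with u hu
  obtain ⟨-, hne⟩ := sep_of_C0 hu
  unfold Pz
  rw [if_pos (by omega), hr, ← Finset.prod_const, Finset.prod_filter, ← Finset.prod_mul_distrib]
  refine Finset.prod_congr rfl fun k _ => ?_
  split_ifs with h
  · have : u - lam k ≠ 0 := sub_ne_zero.mpr (hne k).symm
    rw [h] at this ⊢
    field_simp
  · rw [one_mul]

lemma tendsto_Fp (lam w : ℤ → ℂ) (hconv : ConvCond lam w) (z : ℂ) (hz : Sep lam z) (N : ℤ)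
    (hN : ∀ k, N < k → lam k ≠ z) (n : ℤ) (hn : N < n) :
    Tendsto (fun u => GG (cut n (dd lam w u))) (𝓝[C0 lam] z) (𝓝 (GG (cut n (dd lam w z)))) := by
  have hs := (summable_dd hconv hz).mul_left 4
  obtain ⟨δ, hδ, hk⟩ := hz
  refine tendsto_GG _ _ _ (fun _ => by positivity) hs ?_ ?_
  · have : Metric.ball z (δ / 2) ∈ 𝓝[C0 lam] z :=
      nhdsWithin_le_nhds (Metric.ball_mem_nhds z (by positivity))
    filter_upwards [this] with u hu k
    rw [mem_ball_iff_norm] at hu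
    have hb : ∀ j, n ≤ j → ‖(lam j - u)⁻¹‖ ≤ 2 * ‖(lam j - z)⁻¹‖ := by
      intro j hj
      have h1 := hk j (hN j (by omega))
      have h2 : ‖lam j - z‖ ≤ ‖lam j - u‖ + ‖u - z‖ := by
        have : lam j - z = (lam j - u) + (u - z) := by ring
        rw [this]; exact norm_add_le _ _
      have hp : 0 < ‖lam j - u‖ := by linarith
      have hp' : 0 < ‖lam j - z‖ := by linarith
      rw [norm_inv, norm_inv, ← div_eq_mul_inv, le_div_iff₀ hp', inv_mul_le_iff₀ hp]
      linarith
    unfold cut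
    split_ifs with hnk
    · have e : ∀ v, ‖dd lam w v k‖
          = ‖w k ^ 2‖ * (‖(lam k - v)⁻¹‖ * ‖(lam (k + 1) - v)⁻¹‖) := by
        intro v
        rw [dd, norm_neg, div_eq_mul_inv, mul_inv, norm_mul, norm_mul]
      rw [e, e]
      have h5 := mul_le_mul (hb k hnk) (hb (k + 1) (by omega)) (norm_nonneg _) (by positivity)
      calc _ ≤ ‖w k ^ 2‖ * (2 * ‖(lam k - z)⁻¹‖ * (2 * ‖(lam (k + 1) - z)⁻¹‖)) :=
            mul_le_mul_of_nonneg_left h5 (norm_nonneg _)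
        _ = _ := by ring
    · rw [norm_zero]; positivity
  · intro k
    unfold cut
    split_ifs with hnk
    · have e1 : lam k - z ≠ 0 := sub_ne_zero.mpr (hN k (by omega))
      have e2 : lam (k + 1) - z ≠ 0 := sub_ne_zero.mpr (hN (k + 1) (by omega))
      have hc : ContinuousAt (fun u => dd lam w u k) z := by
        unfold dd
        refine ContinuousAt.neg (ContinuousAt.div (by fun_prop) (by fun_prop) ?_)
        exact mul_ne_zero e1 e2
      exact hc.tendsto.mono_left nhdsWithin_le_nhds
    · exact tendsto_const_nhds

lemma plus_solution (lam w : ℤ → ℂ) (hw : ∀ n, w n ≠ 0) (hconv : ConvCond lam w) (z : ℂ)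
    (hz : Sep lam z) (hfin : {k | lam k = z}.Finite) :
    ∃ φ : ℤ → ℂ,
      (∀ n, Tendsto (fun u => (u - z) ^ rp lam z * f0 lam w u n) (𝓝[C0 lam] z) (𝓝 (φ n))) ∧
      (∃ n, φ n ≠ 0) ∧
      Summable (fun n : ℕ => ‖φ n‖ ^ 2) ∧
      (∀ n, w (n - 1) * φ (n - 1) + lam n * φ n + w n * φ (n + 1) = z * φ n) := by
  haveI := neBot_C0 hz
  obtain ⟨N, hN0, hN⟩ : ∃ N : ℤ, 0 ≤ N ∧ ∀ k, N < k → lam k ≠ z := by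
    obtain ⟨M, hM⟩ := hfin.bddAbove
    refine ⟨max M 0, le_max_right _ _, fun k hk h => ?_⟩
    have : k ≤ M := hM h
    have := le_max_left M 0
    omega
  have hlarge : ∀ n, N ≤ n → Tendsto (fun u => (u - z) ^ rp lam z * f0 lam w u n)
      (𝓝[C0 lam] z) (𝓝 (QQ lam w z n * GG (cut (n + 1) (dd lam w z)))) := by
    intro n hn
    refine ((tendsto_QQ lam w z N hN0 hN n hn).mul
      (tendsto_Fp lam w hconv z hz N hN (n + 1) (by omega))).congr fun u => ?_
    unfold f0; ring
  have hrec : ∀ n, ∀ᶠ u in 𝓝[C0 lam] z,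
      w (n - 1) * ((u - z) ^ rp lam z * f0 lam w u (n - 1))
      + lam n * ((u - z) ^ rp lam z * f0 lam w u n)
      + w n * ((u - z) ^ rp lam z * f0 lam w u (n + 1))
      = u * ((u - z) ^ rp lam z * f0 lam w u n) := by
    intro n
    filter_upwards [self_mem_nhdsWithin] with u hu
    have := f0_rec lam w hw hconv u hu n
    linear_combination (u - z) ^ rp lam z * this
  have hid : Tendsto (fun u : ℂ => u) (𝓝[C0 lam] z) (𝓝 z) :=
    tendsto_id.mono_left nhdsWithin_le_nhds
  have hex2 : ∀ j : ℕ, (∃ l, Tendsto (fun u => (u - z) ^ rp lam z * f0 lam w u (N - j))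
      (𝓝[C0 lam] z) (𝓝 l)) ∧ (∃ l, Tendsto (fun u => (u - z) ^ rp lam z * f0 lam w u (N - j + 1))
      (𝓝[C0 lam] z) (𝓝 l)) := by
    intro j
    induction j with
    | zero => exact ⟨⟨_, hlarge _ (by simp)⟩, ⟨_, hlarge _ (by simp)⟩⟩
    | succ j ih =>
      obtain ⟨⟨l1, h1⟩, ⟨l2, h2⟩⟩ := ih
      have e : N - ((j + 1 : ℕ) : ℤ) = N - j - 1 := by push_cast; ring
      rw [e]
      refine ⟨⟨(w (N - j - 1))⁻¹ * (z * l1 - lam (N - j) * l1 - w (N - j) * l2), ?_⟩,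
        ⟨l1, by rw [sub_add_cancel]; exact h1⟩⟩
      refine Tendsto.congr' ?_ ((((hid.mul h1).sub (h1.const_mul _)).sub (h2.const_mul _)).const_mul
        ((w (N - j - 1))⁻¹))
      filter_upwards [hrec (N - j)] with u hu
      have hne := hw (N - j - 1)
      rw [← hu]
      field_simp
      ring
  have hex : ∀ n, ∃ l, Tendsto (fun u => (u - z) ^ rp lam z * f0 lam w u n)
      (𝓝[C0 lam] z) (𝓝 l) := by
    intro n
    rcases le_total N n with h | h
    · exact ⟨_, hlarge n h⟩
    · have := (hex2 (N - n).toNat).1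
      rwa [Int.toNat_of_nonneg (by omega), sub_sub_cancel] at this
  choose φ hφ using hex
  have hφN : ∀ n, N ≤ n → φ n = QQ lam w z n * GG (cut (n + 1) (dd lam w z)) :=
    fun n hn => tendsto_nhds_unique (hφ n) (hlarge n hn)
  have hsd := summable_dd hconv hz
  have hF1 : Tendsto (fun n : ℤ => GG (cut (n + 1) (dd lam w z))) atTop (𝓝 1) :=
    (tendsto_cut_top _ hsd).comp (tendsto_atTop_add_const_right _ 1 tendsto_id)
  refine ⟨φ, hφ, ?_, ?_, ?_⟩
  · have h1 : ∀ᶠ n : ℤ in atTop, GG (cut (n + 1) (dd lam w z)) ≠ 0 :=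
      hF1.eventually_ne one_ne_zero
    obtain ⟨n, hn1, hn2⟩ := (h1.and (eventually_ge_atTop N)).exists
    refine ⟨n, ?_⟩
    rw [hφN n hn2]
    exact mul_ne_zero (QQ_ne lam w hw z n) hn1
  · obtain ⟨δ, hδ, hk⟩ := hz
    have hcast : Tendsto (fun n : ℕ => (n : ℤ)) atTop atTop := tendsto_natCast_atTop_atTop
    let p : ℕ → ℝ := fun n => ‖QQ lam w z n‖ ^ 2 * ‖lam n - z‖
    have hpos : ∀ᶠ n : ℕ in atTop, N < (n : ℤ) := hcast.eventually_gt_atTop N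
    have hp : Summable p := by
      refine summable_of_ratio_test_tendsto_lt_one (l := 0) zero_lt_one ?_ ?_
      · filter_upwards [hpos] with n hn
        have h1 := norm_pos_iff.mpr (QQ_ne lam w hw z n)
        have h2 := hδ.trans_le (hk n (hN n hn))
        simp only [p]
        positivity
      · have hd0 : Tendsto (fun n : ℕ => ‖dd lam w z n‖) atTop (𝓝 0) := by
          have := hsd.tendsto_cofinite_zero
          exact this.comp (Function.Injective.tendsto_cofinite Nat.cast_injective |>.mono_left
            (Nat.cofinite_eq_atTop ▸ le_rfl))
        refine hd0.congr' ?_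
        filter_upwards [hpos] with n hn
        have h1 := norm_pos_iff.mpr (QQ_ne lam w hw z n)
        have h2 := hδ.trans_le (hk n (hN n hn))
        have hn1 := hN (n + 1) (by omega)
        have h3 := hδ.trans_le (hk (n + 1) hn1)
        simp only [p, dd]
        push_cast
        rw [QQ_succ lam w z n (by omega) hn1]
        simp only [norm_mul, norm_div, norm_pow, norm_neg, norm_norm]
        rw [norm_sub_rev z (lam (n + 1))]
        field_simp
    have hB : ∀ᶠ n : ℕ in atTop, ‖GG (cut ((n : ℤ) + 1) (dd lam w z))‖ ≤ 2 := by
      have := (hF1.comp hcast).norm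
      refine this.eventually_le_const ?_
      simp
    refine Summable.of_norm_bounded_eventually_nat (hp.mul_left (4 / δ)) ?_
    filter_upwards [hpos, hB] with n hn hb
    rw [hφN n hn.le]
    have h2 := hk n (hN n hn)
    simp only [p]
    rw [norm_pow, norm_norm, norm_mul, mul_pow]
    have h4 : ‖GG (cut ((n : ℤ) + 1) (dd lam w z))‖ ^ 2 ≤ 4 := by
      have := norm_nonneg (GG (cut ((n : ℤ) + 1) (dd lam w z)))
      nlinarith
    have h5 : 4 ≤ 4 / δ * ‖lam n - z‖ := by
      rw [div_mul_eq_mul_div, le_div_iff₀ hδ]; linarith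
    calc _ ≤ ‖QQ lam w z n‖ ^ 2 * (4 / δ * ‖lam n - z‖) :=
          mul_le_mul_of_nonneg_left (h4.trans h5) (by positivity)
      _ = _ := by ring
  · intro n
    refine tendsto_nhds_unique_of_eventuallyEq
      ((((hφ (n - 1)).const_mul _).add ((hφ n).const_mul _)).add ((hφ (n + 1)).const_mul _))
      (hid.mul (hφ n)) (hrec n)

end JacobiAux
namespace JacobiAux

open Jacobi

/-- Reflected diagonal. -/
def lr (lam : ℤ → ℂ) : ℤ → ℂ := fun n => lam (-n)

/-- Reflected off-diagonal. -/
def wr (w : ℤ → ℂ) : ℤ → ℂ := fun n => w (-n - 1)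

lemma C0_lr (lam : ℤ → ℂ) : C0 (lr lam) = C0 lam := by
  unfold C0
  congr 2
  exact (Equiv.neg ℤ).surjective.range_comp lam

lemma sep_lr {lam : ℤ → ℂ} {z : ℂ} (h : Sep lam z) : Sep (lr lam) z := by
  obtain ⟨δ, hδ, hk⟩ := h
  exact ⟨δ, hδ, fun k => hk (-k)⟩

lemma fin_lr {lam : ℤ → ℂ} {z : ℂ} (h : {k | lam k = z}.Finite) :
    {k | lr lam k = z}.Finite :=
  h.preimage (f := fun k : ℤ => -k) neg_injective.injOn

lemma dd_lr (lam w : ℤ → ℂ) (u : ℂ) (k : ℤ) :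
    dd (lr lam) (wr w) u k = dd lam w u (-k - 1) := by
  unfold dd lr wr
  rw [show -(k + 1) = -k - 1 by ring, show -k - 1 + 1 = -k by ring, mul_comm (lam (-k) - u)]

/-- The reflection `k ↦ -k - 1`. -/
def refl1 : ℤ ≃ ℤ where
  toFun k := -k - 1
  invFun k := -k - 1
  left_inv k := by ring
  right_inv k := by ring

lemma conv_lr {lam w : ℤ → ℂ} (h : ConvCond lam w) : ConvCond (lr lam) (wr w) := by
  obtain ⟨z₀, hz₀, hs⟩ := h
  refine ⟨z₀, by rwa [C0_lr], ?_⟩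
  rw [← refl1.summable_iff] at hs
  refine hs.congr fun k => ?_
  have := dd_lr lam w z₀ k
  unfold dd at this
  rw [neg_inj] at this
  simp only [Function.comp, refl1, Equiv.coe_fn_mk]
  rw [this]

lemma rz_eq {lam : ℤ → ℂ} {z : ℂ} (h : {k | lam k = z}.Finite) :
    rz lam z = rp lam z + rp (lr lam) z + (if lam 0 = z then 1 else 0) := by
  have e : {n : ℤ | lam n = z} = ({n | 0 < n ∧ lam n = z} ∪ {n | n < 0 ∧ lam n = z})
      ∪ {n | n = 0 ∧ lam n = z} := by
    ext n
    simp only [Set.mem_union, Set.mem_setOf_eq]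
    constructor
    · intro hn
      rcases lt_trichotomy n 0 with h | h | h
      · exact Or.inl (Or.inr ⟨h, hn⟩)
      · exact Or.inr ⟨h, hn⟩
      · exact Or.inl (Or.inl ⟨h, hn⟩)
    · rintro ((h | h) | h) <;> exact h.2
  have f1 : {n | 0 < n ∧ lam n = z}.Finite := h.subset fun n hn => hn.2
  have f2 : {n | n < 0 ∧ lam n = z}.Finite := h.subset fun n hn => hn.2
  have f3 : {n | n = 0 ∧ lam n = z}.Finite := h.subset fun n hn => hn.2
  unfold rz
  rw [e, Set.ncard_union_eq _ (f1.union f2) f3, Set.ncard_union_eq _ f1 f2]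
  · unfold rp lr
    congr 1
    · congr 1
      have : {n : ℤ | n < 0 ∧ lam n = z} = (fun n : ℤ => -n) '' {n | 0 < n ∧ lam (-n) = z} := by
        ext n
        simp only [Set.mem_setOf_eq, Set.mem_image]
        constructor
        · rintro ⟨h1, h2⟩
          exact ⟨-n, ⟨by omega, by rwa [neg_neg]⟩, neg_neg n⟩
        · rintro ⟨m, ⟨h1, h2⟩, rfl⟩
          exact ⟨by omega, h2⟩
      rw [this, Set.ncard_image_of_injective _ neg_injective]
    · split_ifs with h0
      · rw [Set.ncard_eq_one]
        refine ⟨0, ?_⟩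
        ext n
        simp only [Set.mem_setOf_eq, Set.mem_singleton_iff]
        constructor
        · exact fun h => h.1
        · rintro rfl; exact ⟨rfl, h0⟩
      · rw [Set.ncard_eq_zero f3]
        ext n
        simp only [Set.mem_setOf_eq, Set.mem_empty_iff_false, iff_false]
        rintro ⟨rfl, h⟩
        exact h0 h
  · rw [Set.disjoint_left]
    rintro n ⟨h1, _⟩ ⟨h2, _⟩
    omega
  · rw [Set.disjoint_left]
    rintro n (⟨h1, _⟩ | ⟨h1, _⟩) ⟨h2, _⟩ <;> omega

/-- Products of the prefactors of the two solutions. -/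
lemma Pz_mul (lam w : ℤ → ℂ) (hw : ∀ n, w n ≠ 0) (u : ℂ) (hu : ∀ k, lam k ≠ u) (n : ℕ) :
    Pz lam w u n * Pz (lr lam) (wr w) u (-n - 1) * w n = u - lam 0 := by
  have hwr : ∀ n, wr w n ≠ 0 := fun n => hw _
  have hur : ∀ k, lr lam k ≠ u := fun k => hu _
  induction n with
  | zero =>
    have h := Pz_rec (lr lam) (wr w) hwr u hur 0
    have e : u - lam 0 ≠ 0 := sub_ne_zero.mpr (hu 0).symm
    have h0 : ∀ l v : ℤ → ℂ, Pz l v u 0 = 1 := by intro l v; simp [Pz]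
    have h1 := hw 0
    rw [h0] at h
    simp only [lr, wr, neg_zero, zero_sub, neg_neg, sub_self] at h
    simp only [Nat.cast_zero, neg_zero, zero_sub, h0, one_mul]
    change 1 = Pz (lr lam) (wr w) u (-1) * _ at h
    field_simp at h
    exact h.symm
  | succ n ih =>
    have h1 := Pz_rec lam w hw u hu (n + 1)
    have h2 := Pz_rec (lr lam) (wr w) hwr u hur (-n - 1)
    have e : u - lam (n + 1) ≠ 0 := sub_ne_zero.mpr (hu (n + 1)).symm
    have g1 := hw n
    have g2 := hw (n + 1)
    simp only [lr, wr] at h2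
    rw [show -(-(n : ℤ) - 1) = n + 1 by ring, show -(-(n : ℤ) - 1 - 1) - 1 = n + 1 by ring] at h2
    change _ = Pz (lr lam) (wr w) u (-n - 1 - 1) * _ at h2
    change Pz (lr lam) (wr w) u (-n - 1) = _ at h2
    rw [add_sub_cancel_right] at h1
    push_cast
    rw [h1, show -((n : ℤ) + 1) - 1 = -n - 1 - 1 by ring, ← ih, h2]
    field_simp

lemma wronskian_const (lam w : ℤ → ℂ) (u : ℂ) (f g : ℤ → ℂ)
    (hf : ∀ n, w (n - 1) * f (n - 1) + lam n * f n + w n * f (n + 1) = u * f n)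
    (hg : ∀ n, w (n - 1) * g (n - 1) + lam n * g n + w n * g (n + 1) = u * g n) (n : ℕ) :
    w n * (f n * g (n + 1) - f (n + 1) * g n) = w 0 * (f 0 * g 1 - f 1 * g 0) := by
  induction n with
  | zero => simp
  | succ n ih =>
    rw [← ih]
    have h1 := hf (n + 1)
    have h2 := hg (n + 1)
    rw [add_sub_cancel_right] at h1 h2
    push_cast
    linear_combination f (n + 1) * h2 - g (n + 1) * h1

lemma refl_rec {lam w : ℤ → ℂ} {u : ℂ} {f : ℤ → ℂ}
    (hf : ∀ n, wr w (n - 1) * f (n - 1) + lr lam n * f n + wr w n * f (n + 1) = u * f n) (n : ℤ) :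
    w (n - 1) * f (-(n - 1)) + lam n * f (-n) + w n * f (-(n + 1)) = u * f (-n) := by
  have := hf (-n)
  simp only [wr, lr] at this
  rw [neg_neg, show -(-n - 1) - 1 = n by ring] at this
  rw [show -(n - 1) = -n + 1 by ring, show -(n + 1) = -n - 1 by ring]
  linear_combination this

lemma wronskian_eq (lam w : ℤ → ℂ) (hw : ∀ n, w n ≠ 0) (hconv : ConvCond lam w) (u : ℂ)
    (hu : u ∈ C0 lam) :
    w 0 * (f0 lam w u 0 * f0 (lr lam) (wr w) u (-1) - f0 lam w u 1 * f0 (lr lam) (wr w) u 0)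
      = (u - lam 0) * GG (dd lam w u) := by
  obtain ⟨hsep, hne⟩ := sep_of_C0 hu
  have hwr : ∀ n, wr w n ≠ 0 := fun n => hw _
  have hconvr := conv_lr hconv
  have hur : u ∈ C0 (lr lam) := by rwa [C0_lr]
  have hf := f0_rec lam w hw hconv u hu
  have hg := refl_rec (f0_rec (lr lam) (wr w) hwr hconvr u hur)
  have hconst := wronskian_const lam w u (f0 lam w u) (fun n => f0 (lr lam) (wr w) u (-n)) hf hg
  simp only [neg_zero] at hconst
  have hs := summable_dd hconv hsep
  have hsr := summable_dd hconvr (sep_lr hsep)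
  have hG : GG (dd (lr lam) (wr w) u) = GG (dd lam w u) := by
    rw [← GG_reflect (dd lam w u)]
    congr 1
    ext k
    exact dd_lr lam w u k
  have hcast : Tendsto (fun n : ℕ => (n : ℤ)) atTop atTop := tendsto_natCast_atTop_atTop
  have hcastn : Tendsto (fun n : ℕ => -(n : ℤ)) atTop atBot := tendsto_neg_atTop_atBot.comp hcast
  have l1 : Tendsto (fun n : ℕ => GG (cut ((n : ℤ) + 1) (dd lam w u))) atTop (𝓝 1) :=
    (tendsto_cut_top _ hs).comp (tendsto_atTop_add_const_right _ 1 hcast)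
  have l2 : Tendsto (fun n : ℕ => GG (cut ((n : ℤ) + 2) (dd lam w u))) atTop (𝓝 1) :=
    (tendsto_cut_top _ hs).comp (tendsto_atTop_add_const_right _ 2 hcast)
  have l3 : Tendsto (fun n : ℕ => GG (cut (-(n : ℤ)) (dd (lr lam) (wr w) u))) atTop
      (𝓝 (GG (dd lam w u))) := hG ▸ (tendsto_cut_bot _ hsr).comp hcastn
  have l4 : Tendsto (fun n : ℕ => GG (cut (-(n : ℤ) + 1) (dd (lr lam) (wr w) u))) atTop
      (𝓝 (GG (dd lam w u))) :=
    hG ▸ (tendsto_cut_bot _ hsr).comp (tendsto_atBot_add_const_right _ 1 hcastn)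
  have hd0 : Tendsto (fun n : ℕ => dd lam w u n) atTop (𝓝 0) := by
    have := hs.of_norm.tendsto_cofinite_zero
    exact this.comp (Function.Injective.tendsto_cofinite Nat.cast_injective |>.mono_left
      (Nat.cofinite_eq_atTop ▸ le_rfl))
  have hlim := ((l1.mul l3).add ((hd0.mul l2).mul l4)).const_mul (u - lam 0)
  rw [one_mul, zero_mul, zero_mul, add_zero] at hlim
  refine tendsto_nhds_unique (l := (atTop : Filter ℕ)) tendsto_const_nhds (hlim.congr fun n => ?_)
  rw [show (-1 : ℤ) = -1 from rfl, ← hconst n]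
  unfold f0
  have hP := Pz_mul lam w hw u hne n
  have h1 := Pz_rec lam w hw u hne (n + 1)
  have h2 := Pz_rec (lr lam) (wr w) hwr u (fun k => hne _) (-n)
  have e1 : u - lam n ≠ 0 := sub_ne_zero.mpr (hne n).symm
  have e2 : u - lam (n + 1) ≠ 0 := sub_ne_zero.mpr (hne (n + 1)).symm
  have g := hw n
  have hd : dd lam w u n = -(w n ^ 2 / ((u - lam n) * (u - lam (n + 1)))) := by
    unfold dd
    congr 2
    ring
  simp only [lr, wr, neg_neg] at h2
  rw [show -(-(n : ℤ) - 1) - 1 = n by ring] at h2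
  change Pz (lr lam) (wr w) u (-n) = Pz (lr lam) (wr w) u (-n - 1) * _ at h2
  rw [add_sub_cancel_right] at h1
  rw [hd, ← hP, h1, h2, show -((n : ℤ) + 1) = -n - 1 by ring, sub_add_cancel,
    show (n : ℤ) + 1 + 1 = n + 2 by ring]
  field_simp
  ring

lemma solution_zero (lam w : ℤ → ℂ) (hw : ∀ n, w n ≠ 0) (z : ℂ) (h : ℤ → ℂ)
    (hh : ∀ n, w (n - 1) * h (n - 1) + lam n * h n + w n * h (n + 1) = z * h n) (m : ℤ)
    (h0 : h m = 0) (h1 : h (m + 1) = 0) : ∀ n, h n = 0 := by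
  have up : ∀ j : ℕ, h (m + j) = 0 ∧ h (m + j + 1) = 0 := by
    intro j
    induction j with
    | zero => simpa using ⟨h0, h1⟩
    | succ j ih =>
      push_cast
      rw [← add_assoc]
      refine ⟨ih.2, ?_⟩
      have := hh (m + j + 1)
      rw [add_sub_cancel_right, ih.1, ih.2] at this
      simpa [hw] using this
  have down : ∀ j : ℕ, h (m - j) = 0 ∧ h (m - j + 1) = 0 := by
    intro j
    induction j with
    | zero => simpa using ⟨h0, h1⟩
    | succ j ih =>
      push_cast
      rw [← sub_sub]
      refine ⟨?_, by rw [sub_add_cancel]; exact ih.1⟩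
      have := hh (m - j)
      rw [ih.1, ih.2] at this
      simpa [hw] using this
  intro n
  rcases le_total m n with hmn | hmn
  · have := (up (n - m).toNat).1
    rwa [Int.toNat_of_nonneg (by omega), add_sub_cancel] at this
  · have := (down (m - n).toNat).1
    rwa [Int.toNat_of_nonneg (by omega), sub_sub_cancel] at this

lemma wronskian_zero (lam w : ℤ → ℂ) (hw : ∀ n, w n ≠ 0) (z : ℂ) (f g : ℤ → ℂ)
    (hf : ∀ n, w (n - 1) * f (n - 1) + lam n * f n + w n * f (n + 1) = z * f n)
    (hg : ∀ n, w (n - 1) * g (n - 1) + lam n * g n + w n * g (n + 1) = z * g n)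
    (hW : f 0 * g 1 - f 1 * g 0 = 0) (hne : ∃ n, g n ≠ 0) : ∃ c, ∀ n, f n = c * g n := by
  by_cases hg0 : g 0 = 0
  · have hg1 : g 1 ≠ 0 := by
      intro hg1
      obtain ⟨n, hn⟩ := hne
      exact hn (solution_zero lam w hw z g hg 0 hg0 hg1 n)
    refine ⟨f 1 / g 1, fun n => ?_⟩
    rw [← sub_eq_zero]
    refine solution_zero lam w hw z (fun n => f n - f 1 / g 1 * g n) ?_ 0 ?_ ?_ n
    · intro n
      linear_combination hf n - f 1 / g 1 * hg n
    · have : f 0 = 0 := by simpa [hg0, hg1] using hW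
      simp [this, hg0]
    · simp [hg1]
  · refine ⟨f 0 / g 0, fun n => ?_⟩
    rw [← sub_eq_zero]
    refine solution_zero lam w hw z (fun n => f n - f 0 / g 0 * g n) ?_ 0 ?_ ?_ n
    · intro n
      linear_combination hf n - f 0 / g 0 * hg n
    · simp [hg0]
    · simp only [zero_add]
      field_simp
      linear_combination -hW

lemma charF_eq (lam w γ : ℤ → ℂ) (hγ : ∀ n, γ n * γ (n + 1) = w n) (hconv : ConvCond lam w)
    (u : ℂ) (hu : u ∈ C0 lam) : charF lam γ u = GG (dd lam w u) := by
  have hs := summable_dd hconv (sep_of_C0 hu).1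
  have e : ∀ k, γ k ^ 2 / (u - lam k) * (γ (k + 1) ^ 2 / (u - lam (k + 1))) = - dd lam w u k := by
    intro k
    unfold dd
    rw [neg_neg, ← hγ k, div_mul_div_comm]
    congr 1 <;> ring
  unfold charF
  rw [FF_eq]
  · simp only [e, neg_neg]
  · simpa only [e, norm_neg] using hs

lemma fSol₀_eq (lam w γ : ℤ → ℂ) (hγ : ∀ n, γ n * γ (n + 1) = w n) (hconv : ConvCond lam w)
    (u : ℂ) (hu : u ∈ C0 lam) (n : ℤ) : fSol₀ lam w γ u n = f0 lam w u n := by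
  have hs := summable_dd hconv (sep_of_C0 hu).1
  unfold fSol₀ f0 Fplus FFon
  congr 1
  have e : ∀ k, {k | n + 1 ≤ k}.indicator (fun k => γ k ^ 2 / (lam k - u)) k *
      {k | n + 1 ≤ k}.indicator (fun k => γ k ^ 2 / (lam k - u)) (k + 1) =
      - cut (n + 1) (dd lam w u) k := by
    intro k
    unfold cut
    simp only [Set.indicator, Set.mem_setOf_eq]
    split_ifs with h1 h2
    · unfold dd
      rw [neg_neg, ← hγ k, div_mul_div_comm]
      congr 1; ring
    · omega
    · simp
    · simp
  rw [FF_eq]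
  · simp only [e, neg_neg]
  · simpa only [e, norm_neg] using summable_cut (n + 1) _ hs

lemma fSol_eq (lam w γ : ℤ → ℂ) (hγ : ∀ n, γ n * γ (n + 1) = w n) (hconv : ConvCond lam w)
    (z : ℂ) (hz : Sep lam z) (φ : ℤ → ℂ)
    (hφ : ∀ n, Tendsto (fun u => (u - z) ^ rp lam z * f0 lam w u n) (𝓝[C0 lam] z) (𝓝 (φ n))) :
    fSol lam w γ z = φ := by
  haveI := neBot_C0 hz
  funext n
  unfold fSol
  split_ifs with h
  · rw [fSol₀_eq lam w γ hγ hconv z h]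
    have hr : rp lam z = 0 := by
      unfold rp
      have : {n : ℤ | 0 < n ∧ lam n = z} = ∅ := by
        ext k; simp [(sep_of_C0 h).2 k]
      rw [this, Set.ncard_empty]
    have h2 := (hφ n).mono_left (pure_le_nhdsWithin h)
    rw [hr] at h2
    simp only [pow_zero, one_mul] at h2
    exact tendsto_nhds_unique (tendsto_pure_nhds _ _) h2
  · refine Tendsto.limUnder_eq ((hφ n).congr' ?_)
    filter_upwards [self_mem_nhdsWithin] with u hu
    rw [fSol₀_eq lam w γ hγ hconv u hu]

end JacobiAux

/-- every point of `𝔷(𝒥)` is an eigenvalue of `J_max` with eigenvector `f(z)`;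
in particular `𝔷(𝒥) ⊆ spec_p(J_max) ∖ der(λ)`. -/
theorem statement4 (lam w γ : ℤ → ℂ) (hw : ∀ n, w n ≠ 0)
    (hγ : ∀ n, γ n * γ (n + 1) = w n) (hconv : Jacobi.ConvCond lam w)
    (z : ℂ) (hz : z ∈ Jacobi.Zset lam w γ) :
    Memℓp (Jacobi.fSol lam w γ z) 2 ∧
    Jacobi.fSol lam w γ z ≠ 0 ∧
    (∀ n : ℤ, Jacobi.Jop lam w (Jacobi.fSol lam w γ z) n = z * Jacobi.fSol lam w γ z n) ∧
    Jacobi.IsEV (Jacobi.Jmax lam w) z ∧ z ∉ Jacobi.der lam := by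
  obtain ⟨hder, hlim⟩ := hz
  obtain ⟨hsep, hfin⟩ := JacobiAux.sep_of_not_der hder
  haveI := JacobiAux.neBot_C0 hsep
  obtain ⟨φ, hφ, hφne, hφs, hφr⟩ := JacobiAux.plus_solution lam w hw hconv z hsep hfin
  obtain ⟨ψ, hψ, hψne, hψs, hψr⟩ := JacobiAux.plus_solution (JacobiAux.lr lam) (JacobiAux.wr w)
    (fun n => hw _) (JacobiAux.conv_lr hconv) z (JacobiAux.sep_lr hsep) (JacobiAux.fin_lr hfin)
  rw [JacobiAux.C0_lr] at hψ
  have hid : Tendsto (fun u : ℂ => u) (𝓝[Jacobi.C0 lam] z) (𝓝 z) :=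
    tendsto_id.mono_left nhdsWithin_le_nhds
  have hW : w 0 * (φ 0 * ψ (-1) - φ 1 * ψ 0) = 0 := by
    have l1 := (((hφ 0).mul (hψ (-1))).sub ((hφ 1).mul (hψ 0))).const_mul (w 0)
    have l2 : Tendsto (fun u => (if lam 0 = z then 1 else u - lam 0) *
        ((u - z) ^ Jacobi.rz lam z * Jacobi.charF lam γ u)) (𝓝[Jacobi.C0 lam] z) (𝓝 0) := by
      split_ifs
      · simpa using hlim
      · simpa using (hid.sub_const (lam 0)).mul hlim
    refine tendsto_nhds_unique_of_eventuallyEq l1 l2 ?_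
    filter_upwards [self_mem_nhdsWithin] with u hu
    have h1 := JacobiAux.wronskian_eq lam w hw hconv u hu
    rw [JacobiAux.charF_eq lam w γ hγ hconv u hu, JacobiAux.rz_eq hfin]
    split_ifs with h0
    · rw [h0] at h1
      linear_combination (u - z) ^ Jacobi.rp lam z * (u - z) ^ Jacobi.rp (JacobiAux.lr lam) z * h1
    · linear_combination (u - z) ^ Jacobi.rp lam z * (u - z) ^ Jacobi.rp (JacobiAux.lr lam) z * h1
  have hW' := (mul_eq_zero.mp hW).resolve_left (hw 0)
  obtain ⟨c, hc⟩ := JacobiAux.wronskian_zero lam w hw z φ (fun n => ψ (-n)) hφr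
    (JacobiAux.refl_rec hψr) (by simpa using hW')
    (by obtain ⟨n, hn⟩ := hψne; exact ⟨-n, by rwa [neg_neg]⟩)
  have hf := JacobiAux.fSol_eq lam w γ hγ hconv z hsep φ hφ
  rw [hf]
  have hmem : Memℓp φ 2 := by
    refine memℓp_gen ?_
    have : Summable fun n : ℤ => ‖φ n‖ ^ 2 := by
      refine Summable.of_nat_of_neg hφs ?_
      refine (hψs.mul_left (‖c‖ ^ 2)).congr fun n => ?_
      rw [hc, norm_mul, mul_pow, neg_neg]
    simpa using this
  have hne : φ ≠ 0 := by
    rintro rfl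
    obtain ⟨n, hn⟩ := hφne
    exact hn rfl
  have hJ : ∀ n : ℤ, Jacobi.Jop lam w φ n = z * φ n := hφr
  have hJ' : Jacobi.Jop lam w φ = z • φ := by
    funext n
    simpa using hJ n
  refine ⟨hmem, hne, hJ, ?_, hder⟩
  have hdom : (⟨φ, hmem⟩ : Jacobi.ℓ2) ∈ (Jacobi.Jmax lam w).domain := by
    show Memℓp (Jacobi.Jop lam w φ) 2
    rw [hJ']
    exact hmem.const_smul z
  refine ⟨⟨⟨φ, hmem⟩, hdom⟩, ?_, ?_⟩
  · intro h
    exact hne (congrArg (fun x : Jacobi.ℓ2 => (x : ℤ → ℂ)) h)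
  · apply lp.ext
    exact hJ'

end
end
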